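/- Let X be a geometrically integral curve over a perfect field k, let L ⊇ k be an algebraic field extension, and let d = γ_L(X). If X has a k-rational point and d ≤ 2, then γ_k(X) = d. -/

import Mathlib

open IntermediateField

/-- The gonality of the function field `F` of a curve over `k`: the smallest degree
`[F : k(f)]` of a nonconstant rational function `f ∈ F`, i.e. the smallest degree of a
dominant rational map from the curve to `ℙ¹_k`. -/
noncomputable def gonality (k F : Type*) [Field k] [Field F] [Algebra k F] : ℕ :=
  sInf {d : ℕ | ∃ f : F, Transcendental k f ∧
    Module.finrank (IntermediateField.adjoin k {f}) F = d}

/-- `F` is the function field of a curve over `k`: a finitely generated field extension of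
transcendence degree 1, i.e. a finite extension of some `k(x)` with `x` transcendental. -/
def IsFunctionField (k F : Type*) [Field k] [Field F] [Algebra k F] : Prop :=
  ∃ x : F, Transcendental k x ∧
    FiniteDimensional (IntermediateField.adjoin k {x}) F

/-- A place of the function field `F/k`: a valuation subring of `F` containing `k`
and different from `F` itself.  These correspond to the closed points of the smooth
projective model of the curve. -/
structure FFPlace (k F : Type*) [Field k] [Field F] [Algebra k F] where
  asSubring : ValuationSubring F
  algebraMap_mem : ∀ a : k, algebraMap k F a ∈ asSubring
  ne_top : asSubring ≠ ⊤

variable (k F : Type*) [Field k] [Field F] [Algebra k F]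

/-- The degree of a place: the `k`-dimension of its residue field. -/
noncomputable def FFPlace.degree (P : FFPlace k F) : ℕ :=
  letI : Algebra k (IsLocalRing.ResidueField P.asSubring) :=
    ((IsLocalRing.residue (P.asSubring : Type _)).comp
      ((algebraMap k F).codRestrict P.asSubring.toSubring P.algebraMap_mem)).toAlgebra
  Module.finrank k (IsLocalRing.ResidueField P.asSubring)

/-- The space of adeles (repartitions) of `F/k`: families `(α_P)_P` indexed by the places of
`F/k` with `α_P` integral at all but finitely many places, as a `k`-submodule of `Π_P F`. -/
def adeleSubmodule : Submodule k (FFPlace k F → F) where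
  carrier := {α | {P : FFPlace k F | α P ∉ P.asSubring}.Finite}
  zero_mem' := by
    show {P : FFPlace k F | (0 : F) ∉ P.asSubring}.Finite
    convert Set.finite_empty using 2
    ext P
    simp [zero_mem]
  add_mem' := by
    intro a b ha hb
    refine Set.Finite.subset (ha.union hb) ?_
    intro P hP
    rw [Set.mem_union]
    by_contra h
    push_neg at h
    simp only [Set.mem_setOf_eq, not_not] at h
    exact hP (add_mem h.1 h.2)
  smul_mem' := by
    intro c α hα
    refine Set.Finite.subset hα ?_
    intro P hP
    by_contra h
    simp only [Set.mem_setOf_eq, not_not] at h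
    refine hP ?_
    show c • α P ∈ P.asSubring
    rw [Algebra.smul_def]
    exact mul_mem (P.algebraMap_mem c) h

/-- The adeles that are integral at every place. -/
def integralAdeles : Submodule k (FFPlace k F → F) where
  carrier := {α | ∀ P : FFPlace k F, α P ∈ P.asSubring}
  zero_mem' := fun P => zero_mem _
  add_mem' := fun ha hb P => add_mem (ha P) (hb P)
  smul_mem' := by
    intro c α hα P
    show c • α P ∈ P.asSubring
    rw [Algebra.smul_def]
    exact mul_mem (P.algebraMap_mem c) (hα P)

/-- The principal adeles: the diagonal image of `F`. -/
def principalAdeles : Submodule k (FFPlace k F → F) :=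
  LinearMap.range (LinearMap.pi fun _ : FFPlace k F => (LinearMap.id : F →ₗ[k] F))

/-- The genus of the function field `F/k`, defined à la Chevalley/Weil as the `k`-dimension of
`A / (A(0) + F)`, where `A` is the space of adeles, `A(0)` the everywhere-integral ones and `F`
the principal ones.  For the function field of a geometrically integral smooth projective curve
this is the usual genus. -/
noncomputable def genus : ℕ :=
  Module.finrank k
    (↥(adeleSubmodule k F) ⧸
      ((integralAdeles k F ⊔ principalAdeles k F).comap (adeleSubmodule k F).subtype))


section Valuation

variable {K E Γ : Type*} [Field K] [Field E] [Algebra K E] [LinearOrderedCommGroupWithZero Γ]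
  (v : Valuation E Γ)

open Polynomial in
lemma Valuation.map_aeval_eq_pow (hK : ∀ c : K, c ≠ 0 → v (algebraMap K E c) = 1) {f : E}
    (hf : 1 < v f) (r : K[X]) (hr : r ≠ 0) : v (aeval f r) = v f ^ r.natDegree := by
  induction hn : r.natDegree generalizing r with
  | zero =>
    rw [eq_C_of_natDegree_eq_zero hn] at hr ⊢
    rw [aeval_C, pow_zero]
    exact hK _ (by simpa using hr)
  | succ n ih =>
    have hd : r.divX ≠ 0 := by
      intro h
      have := r.natDegree_divX_eq_natDegree_tsub_one
      rw [← divX_mul_X_add r, h] at hn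
      simp at hn
    have h1 := ih r.divX hd (by rw [natDegree_divX_eq_natDegree_tsub_one, hn]; rfl)
    have h2 : v (aeval f r.divX * f) = v f ^ (n + 1) := by rw [map_mul, h1, pow_succ]
    have h3 : v (algebraMap K E (r.coeff 0)) < v (aeval f r.divX * f) := by
      rw [h2]
      refine lt_of_le_of_lt ?_ (one_lt_pow₀ hf n.succ_ne_zero)
      by_cases h : r.coeff 0 = 0
      · simp [h]
      · exact (hK _ h).le
    nth_rw 1 [← divX_mul_X_add r]
    rw [map_add, map_mul, aeval_X, aeval_C, v.map_add_eq_of_lt_left h3, h2]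

lemma Valuation.transcendental_of_one_lt (hK : ∀ c : K, c ≠ 0 → v (algebraMap K E c) = 1) {f : E}
    (hf : 1 < v f) : Transcendental K f := by
  rw [transcendental_iff]
  intro r hr
  by_contra h
  have := v.map_aeval_eq_pow hK hf r h
  rw [hr, map_zero] at this
  exact (pow_pos (zero_lt_one.trans hf) _).ne this

lemma Valuation.exists_zpow_of_mem_adjoin
    (hK : ∀ c : K, c ≠ 0 → v (algebraMap K E c) = 1) {f : E}
    (hf : 1 < v f) {g : E} (hg : g ∈ K⟮f⟯) (hg0 : g ≠ 0) : ∃ n : ℤ, v g = v f ^ n := by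
  obtain ⟨r, s, rfl⟩ := (mem_adjoin_simple_iff _ _).1 hg
  have hr : r ≠ 0 := by rintro rfl; simp at hg0
  have hs : s ≠ 0 := by rintro rfl; simp at hg0
  refine ⟨r.natDegree - s.natDegree, ?_⟩
  rw [map_div₀, v.map_aeval_eq_pow hK hf r hr, v.map_aeval_eq_pow hK hf s hs,
    zpow_sub₀ (zero_lt_one.trans hf).ne', zpow_natCast, zpow_natCast]

open Polynomial in
/-- Two generators of a rational function field having a pole at a common place of degree one
differ by an affine substitution. -/
lemma Valuation.exists_affine_of_adjoin_eq
    (hK : ∀ c : K, c ≠ 0 → v (algebraMap K E c) = 1) {f g : E}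
    (hf : 1 < v f) (hg : 1 < v g) (h : K⟮g⟯ = K⟮f⟯) :
    ∃ a b : K, g = algebraMap K E a * f + algebraMap K E b := by
  have hft := v.transcendental_of_one_lt hK hf
  let ψ : RatFunc K →ₐ[K] E :=
    (IntermediateField.val _).comp (RatFunc.algEquivOfTranscendental f hft).toAlgHom
  have hψ (p : K[X]) : ψ (algebraMap _ _ p) = aeval f p := by
    simp [ψ]
  have hψX : ψ RatFunc.X = f := by rw [← RatFunc.algebraMap_X, hψ, aeval_X]
  have hgf : g ∈ K⟮f⟯ := h ▸ mem_adjoin_simple_self K g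
  have hrange (z) (hz : z ∈ K⟮f⟯) : ∃ r, ψ r = z := by
    obtain ⟨r, s, rfl⟩ := (mem_adjoin_simple_iff _ _).1 hz
    exact ⟨algebraMap _ _ r / algebraMap _ _ s, by rw [map_div₀, hψ, hψ]⟩
  obtain ⟨r, hr⟩ := hrange g hgf
  have htop : K⟮r⟯ = ⊤ := by
    rw [← RatFunc.adjoin_X, eq_comm]
    apply_fun IntermediateField.map ψ using IntermediateField.map_injective ψ
    rw [IntermediateField.adjoin_map, IntermediateField.adjoin_map, Set.image_singleton,
      Set.image_singleton, hr, hψX, h]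
  have hdeg := RatFunc.finrank_eq_max_natDegree r
  rw [htop, IntermediateField.finrank_top] at hdeg
  have hgr : g = aeval f r.num / aeval f r.denom := by
    rw [← hr, ← hψ, ← hψ, ← map_div₀, RatFunc.num_div_denom]
  have hrnum : r.num ≠ 0 := by
    rintro h0
    rw [h0] at hgr
    simp [hgr] at hg
  have hv : v g * v f ^ r.denom.natDegree = v f ^ r.num.natDegree := by
    rw [← v.map_aeval_eq_pow hK hf _ hrnum, ← v.map_aeval_eq_pow hK hf _ r.denom_ne_zero,
      ← map_mul]
    congr 1
    rw [hgr, div_mul_cancel₀]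
    exact fun h0 => r.denom_ne_zero ((transcendental_iff.1 hft) _ h0)
  have hlt : r.denom.natDegree < r.num.natDegree := by
    by_contra! hle
    have := pow_le_pow_right₀ hf.le hle
    have h2 : v f ^ r.denom.natDegree < v g * v f ^ r.denom.natDegree :=
      lt_mul_of_one_lt_left (pow_pos (zero_lt_one.trans hf) _) hg
    rw [hv] at h2
    exact absurd this (not_le.2 h2)
  have hd0 : r.denom = 1 := by
    refine r.monic_denom.natDegree_eq_zero.1 (by omega)
  obtain ⟨a, b, hab⟩ := exists_eq_X_add_C_of_natDegree_le_one (p := r.num) (by omega)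
  refine ⟨a, b, ?_⟩
  rw [hgr, hd0, hab]
  simp

end Valuation

section Bivariate

open Polynomial Bivariate

variable {K E : Type*} [Field K] [Field E] [Algebra K E]

open scoped algebraAdjoinAdjoin in
lemma exists_aevalAeval_eq_zero_of_finrank_le {x : E} {n : ℕ}
    [FiniteDimensional K⟮x⟯ E] (hn : Module.finrank K⟮x⟯ E ≤ n) (y : E) :
    ∃ P : K[X][Y], P ≠ 0 ∧ P.natDegree ≤ n ∧ P.aevalAeval x y = 0 := by
  have h1 : ¬ LinearIndependent K⟮x⟯ (fun i : Fin (n + 1) => y ^ (i : ℕ)) := by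
    intro h
    have := h.fintype_card_le_finrank
    simp at this
    omega
  rw [← LinearIndependent.iff_fractionRing (R := Algebra.adjoin K {x}),
    Fintype.not_linearIndependent_iff] at h1
  obtain ⟨g, hg, i, hi⟩ := h1
  have hp (j) : ∃ p : K[X], aeval x p = (g j : E) :=
    (Algebra.adjoin_singleton_eq_range_aeval K x).le (g j).2
  choose p hp using hp
  refine ⟨∑ j : Fin (n + 1), monomial (j : ℕ) (p j), ?_, ?_, ?_⟩
  · intro h
    apply hi
    have := congr_arg (fun q => q.coeff (i : ℕ)) h
    simp only [finsetSum_coeff, coeff_monomial, Fin.val_inj, Finset.sum_ite_eq',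
      Finset.mem_univ, if_true, coeff_zero] at this
    ext
    rw [← hp, this, map_zero]
    rfl
  · refine natDegree_sum_le_of_forall_le _ _ fun j _ => ?_
    exact (natDegree_monomial_le _).trans (by omega)
  · rw [map_sum, ← hg]
    refine Finset.sum_congr rfl fun j _ => ?_
    rw [← C_mul_X_pow_eq_monomial, map_mul, map_pow, aevalAeval_C, aevalAeval_Y, hp]
    rfl

lemma aevalAeval_eq_eval₂ (x y : E) (P : K[X][Y]) :
    P.aevalAeval x y = P.eval₂ (aeval x).toRingHom y := by
  induction P using Polynomial.induction_on' with
  | add p q hp hq => rw [map_add, hp, hq, eval₂_add]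
  | monomial n a =>
    rw [← C_mul_X_pow_eq_monomial, map_mul, map_pow, aevalAeval_C, aevalAeval_Y]
    simp

lemma coeff_coeff_swap {R : Type*} [CommSemiring R] (P : R[X][Y]) (i j : ℕ) :
    ((Bivariate.swap P).coeff i).coeff j = (P.coeff j).coeff i := by
  induction P using Polynomial.induction_on' with
  | add p q hp hq => simp [hp, hq]
  | monomial n a =>
    induction a using Polynomial.induction_on' with
    | add p q hp hq => simp only [map_add, coeff_add, hp, hq]
    | monomial m a =>
      rw [swap_monomial_monomial]
      simp only [coeff_monomial]
      split_ifs <;> simp_all [coeff_monomial]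

lemma exists_biquadratic {x y : E} (hy : Transcendental K y)
    [FiniteDimensional K⟮x⟯ E] [FiniteDimensional K⟮y⟯ E] {m : ℕ}
    (hm : Module.finrank K⟮x⟯ E ≤ m) (hn : Module.finrank K⟮y⟯ E ≤ 2) (hxy : x ∉ K⟮y⟯) :
    ∃ Q : K[X][Y], Q ≠ 0 ∧ Q.natDegree ≤ 2 ∧ (∀ i, (Q.coeff i).natDegree ≤ m) ∧
      Q.aevalAeval y x = 0 := by
  classical
  obtain ⟨P, hP0, hPn, hP⟩ := exists_aevalAeval_eq_zero_of_finrank_le hm y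
  obtain ⟨Q', hQ'0, hQ'n, hQ'⟩ := exists_aevalAeval_eq_zero_of_finrank_le hn x
  let : NormalizedGCDMonoid K[X] := Classical.choice inferInstance
  set Q := Q'.primPart
  have hQ0 : Q ≠ 0 := Q'.primPart_ne_zero
  have hQp : Q.IsPrimitive := Q'.isPrimitive_primPart
  have hQn : Q.natDegree ≤ 2 := by rwa [Q'.natDegree_primPart]
  have hQ : Q.aevalAeval y x = 0 := by
    rw [Q'.eq_C_content_mul_primPart, map_mul, aevalAeval_C, mul_eq_zero] at hQ'
    refine hQ'.resolve_left fun h => hQ'0 ?_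
    rw [← content_eq_zero_iff]
    exact (transcendental_iff.1 hy) _ h
  let φ : RatFunc K →ₐ[K] E :=
    (IntermediateField.val _).comp (RatFunc.algEquivOfTranscendental y hy).toAlgHom
  have hφ (p : K[X]) : φ (algebraMap _ _ p) = aeval y p := by
    simp [φ]
  have hφmem (r) : φ r ∈ K⟮y⟯ := by simp [φ]
  have hev (R : K[X][Y]) : (R.map (algebraMap K[X] (RatFunc K))).eval₂ φ.toRingHom x =
      R.aevalAeval y x := by
    rw [aevalAeval_eq_eval₂, eval₂_map]
    congr 1
    refine RingHom.ext fun p => ?_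
    exact hφ p
  have hdvd : Q ∣ Bivariate.swap P := by
    refine hQp.dvd_of_fraction_map_dvd_fraction_map (K := RatFunc K) ?_
    set q := Q.map (algebraMap K[X] (RatFunc K)) with hq
    set p := (Bivariate.swap P).map (algebraMap K[X] (RatFunc K)) with hp
    have hq0 : q ≠ 0 := by
      rwa [hq, Ne, Polynomial.map_eq_zero_iff (IsFractionRing.injective _ _)]
    rw [← EuclideanDomain.mod_eq_zero]
    have hr : (p % q).eval₂ φ.toRingHom x = 0 := by
      rw [EuclideanDomain.mod_eq_sub_mul_div, eval₂_sub, eval₂_mul, hp, hq, hev, hev, hQ,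
        aevalAeval_swap, hP]
      simp
    have hdeg : (p % q).natDegree ≤ 1 := by
      by_cases h1 : p % q = 0
      · simp [h1]
      have := natDegree_lt_natDegree h1 (degree_mod_lt p hq0)
      have h2 : q.natDegree ≤ 2 := natDegree_map_le.trans hQn
      omega
    obtain ⟨a, b, hab⟩ := exists_eq_X_add_C_of_natDegree_le_one hdeg
    rw [hab] at hr ⊢
    simp only [eval₂_add, eval₂_mul, eval₂_C, eval₂_X] at hr
    have ha : a = 0 := by
      by_contra ha
      apply hxy
      have : x = φ (-b / a) := by
        have : φ a ≠ 0 := by simpa using ha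
        rw [map_div₀, eq_div_iff this, map_neg]
        linear_combination hr
      rw [this]
      exact hφmem _
    subst ha
    simpa using hr
  have hdvd2 : Bivariate.swap Q ∣ P := by
    have := map_dvd Bivariate.swap hdvd
    rwa [swap_swap_apply] at this
  refine ⟨Q, hQ0, hQn, fun i => ?_, hQ⟩
  have h3 := (natDegree_le_of_dvd hdvd2 hP0).trans hPn
  refine natDegree_le_iff_coeff_eq_zero.2 fun j hj => ?_
  rw [← coeff_coeff_swap, coeff_eq_zero_of_natDegree_lt (h3.trans_lt hj), coeff_zero]

/-- Two functions of degree at most two satisfy a biquadratic relation. -/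
lemma exists_biquadratic_relation {x y : E} (hy : Transcendental K y)
    [FiniteDimensional K⟮x⟯ E] [FiniteDimensional K⟮y⟯ E]
    (hm : Module.finrank K⟮x⟯ E ≤ 2) (hn : Module.finrank K⟮y⟯ E ≤ 2) (hxy : x ∉ K⟮y⟯) :
    ∃ h : ℕ → ℕ → K, (∃ i < 3, ∃ j < 3, h i j ≠ 0) ∧
      ∑ i ∈ Finset.range 3, ∑ j ∈ Finset.range 3, algebraMap K E (h i j) * x ^ i * y ^ j = 0 := by
  obtain ⟨Q, hQ0, hQn, hQm, hQ⟩ := exists_biquadratic hy hm hn hxy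
  refine ⟨fun i j => (Q.coeff i).coeff j, ?_, ?_⟩
  · obtain ⟨i, hi⟩ : ∃ i, Q.coeff i ≠ 0 := by
      by_contra! h
      exact hQ0 (Polynomial.ext (by simpa using h))
    obtain ⟨j, hj⟩ : ∃ j, (Q.coeff i).coeff j ≠ 0 := by
      by_contra! h
      exact hi (Polynomial.ext (by simpa using h))
    exact ⟨i, by have := le_natDegree_of_ne_zero hi; omega, j,
      by have := le_natDegree_of_ne_zero hj; have := hQm i; omega, hj⟩
  · rw [← hQ, aevalAeval_eq_eval₂, eval₂_eq_sum_range' _ (Nat.lt_succ_of_le hQn)]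
    refine Finset.sum_congr rfl fun i _ => ?_
    rw [AlgHom.toRingHom_eq_coe, RingHom.coe_coe, aeval_eq_sum_range' (Nat.lt_succ_of_le (hQm i)),
      Finset.sum_mul]
    refine Finset.sum_congr rfl fun j _ => ?_
    rw [Algebra.smul_def]
    ring

end Bivariate

section Curves

variable {K E : Type*} [Field K] [Field E] [Algebra K E]

lemma transcendental_of_forall_ne [IsAlgClosed K] {w : E} (hw : ∀ c : K, w ≠ algebraMap K E c) :
    Transcendental K w := by
  intro h
  have := isAlgebraic_adjoin_simple h.isIntegral
  obtain ⟨c, hc⟩ := (IsAlgClosed.algebraMap_bijective_of_isIntegral (k := K) (K := K⟮w⟯)).2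
    ⟨w, mem_adjoin_simple_self K w⟩
  exact hw c (congr_arg Subtype.val hc).symm

lemma adjoin_pair_eq_top_of_finrank_le_two {x y : E} [FiniteDimensional K⟮x⟯ E]
    (hx : Module.finrank K⟮x⟯ E ≤ 2) (hy : y ∉ K⟮x⟯) : K⟮x, y⟯ = ⊤ := by
  have h1 := Module.finrank_mul_finrank K⟮x⟯ K⟮x⟯⟮y⟯ E
  have h2 : Module.finrank K⟮x⟯ K⟮x⟯⟮y⟯ ≠ 1 := by
    intro h
    rw [IntermediateField.finrank_eq_one_iff] at h
    have h3 := mem_adjoin_simple_self K⟮x⟯ y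
    rw [h, IntermediateField.mem_bot] at h3
    obtain ⟨z, rfl⟩ := h3
    exact hy z.2
  have h3 : 0 < Module.finrank K⟮x⟯ K⟮x⟯⟮y⟯ := Module.finrank_pos
  have h4 : 0 < Module.finrank K⟮x⟯⟮y⟯ E := Module.finrank_pos
  have h5 : Module.finrank K⟮x⟯⟮y⟯ E = 1 := by
    nlinarith [h2, Nat.succ_le_of_lt h3, (by omega : 2 ≤ Module.finrank K⟮x⟯ K⟮x⟯⟮y⟯)]
  rw [IntermediateField.finrank_eq_one_iff_eq_top] at h5
  rw [← adjoin_simple_adjoin_simple, h5]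
  rfl

lemma exists_conic_parameter [IsAlgClosed K] {x y : E} (hxy : x ∉ K⟮y⟯) (hyx : y ∉ K⟮x⟯)
    {a b c d e f : K} (h0 : a ≠ 0 ∨ b ≠ 0 ∨ c ≠ 0 ∨ d ≠ 0 ∨ e ≠ 0 ∨ f ≠ 0)
    (h : algebraMap K E a * x ^ 2 + algebraMap K E b * x * y + algebraMap K E c * y ^ 2 +
      algebraMap K E d * x + algebraMap K E e * y + algebraMap K E f = 0) :
    ∃ w : E, x ∈ K⟮w⟯ ∧ y ∈ K⟮w⟯ := by
  have hy (r : K) : y ≠ algebraMap K E r := fun h => hyx (h ▸ IntermediateField.algebraMap_mem _ r)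
  have hyt := transcendental_of_forall_ne hy
  have hw (t r : K) : x - algebraMap K E t * y ≠ algebraMap K E r := by
    intro h
    apply hxy
    rw [sub_eq_iff_eq_add.1 h]
    exact add_mem (_root_.algebraMap_mem _ _)
      (mul_mem (_root_.algebraMap_mem _ _) (mem_adjoin_simple_self K y))
  have quad {w : E} (hw : ∀ r, w ≠ algebraMap K E r) {a d f : K} (ha : a ≠ 0) :
      algebraMap K E a * w ^ 2 + algebraMap K E d * w + algebraMap K E f ≠ 0 := by
    intro h
    refine ha ?_
    have := transcendental_iff.1 (transcendental_of_forall_ne hw)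
      (.C a * .X ^ 2 + .C d * .X + .C f) (by simpa using h)
    simpa using congr_arg (fun p => p.coeff 2) this
  have lin {w : E} (hw : ∀ r, w ≠ algebraMap K E r) {d f : K}
      (h : algebraMap K E d * w + algebraMap K E f = 0) : d = 0 ∧ f = 0 := by
    by_cases hd : d = 0
    · subst hd
      simpa using h
    · refine (hw (-f / d) ?_).elim
      have : algebraMap K E d ≠ 0 := by simpa using hd
      rw [map_div₀, eq_div_iff this, map_neg]
      linear_combination h
  have main {t : K} (ht : a * t ^ 2 + b * t + c = 0) (hab : a ≠ 0 ∨ b ≠ 0) :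
      ∃ w : E, x ∈ K⟮w⟯ ∧ y ∈ K⟮w⟯ := by
    set w := x - algebraMap K E t * y with hwd
    have hw' := hw t
    have hxw : x = w + algebraMap K E t * y := by rw [hwd]; ring
    refine ⟨w, ?_⟩
    have ht' := congr_arg (algebraMap K E) ht
    simp only [map_add, map_mul, map_pow, map_zero] at ht'
    have hrel : (algebraMap K E (2 * a * t + b) * w + algebraMap K E (d * t + e)) * y =
        -(algebraMap K E a * w ^ 2 + algebraMap K E d * w + algebraMap K E f) := by
      simp only [map_add, map_mul, map_ofNat]
      rw [hxw] at h
      linear_combination h - y ^ 2 * ht'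
    have hne : algebraMap K E (2 * a * t + b) * w + algebraMap K E (d * t + e) ≠ 0 := by
      intro h0
      rw [h0, zero_mul, eq_comm, neg_eq_zero] at hrel
      by_cases ha : a = 0
      · have := (lin hw' h0).1
        simp [ha] at this
        tauto
      · exact quad hw' ha hrel
    have hym : y ∈ K⟮w⟯ := by
      have : y = -(algebraMap K E a * w ^ 2 + algebraMap K E d * w + algebraMap K E f) /
          (algebraMap K E (2 * a * t + b) * w + algebraMap K E (d * t + e)) := by
        rw [eq_div_iff hne]
        linear_combination hrel
      rw [this]
      have h1 := mem_adjoin_simple_self K w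
      refine div_mem (neg_mem (add_mem (add_mem (mul_mem (_root_.algebraMap_mem _ _) (pow_mem h1 2))
        (mul_mem (_root_.algebraMap_mem _ _) h1)) (_root_.algebraMap_mem _ _)))
        (add_mem (mul_mem (_root_.algebraMap_mem _ _) h1) (_root_.algebraMap_mem _ _))
    refine ⟨?_, hym⟩
    nth_rw 1 [hxw]
    exact add_mem (mem_adjoin_simple_self K w) (mul_mem (_root_.algebraMap_mem _ _) hym)
  by_cases ha : a = 0
  · by_cases hb : b = 0
    · subst ha hb
      by_cases hd : d = 0
      · subst hd
        exfalso
        simp only [map_zero, zero_mul, zero_add, add_zero] at h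
        by_cases hc : c = 0
        · subst hc
          have := lin hy (by simpa using h)
          tauto
        · exact quad hy hc h
      · refine (hxy ?_).elim
        have hd' : algebraMap K E d ≠ 0 := by simpa using hd
        have : x = -(algebraMap K E c * y ^ 2 + algebraMap K E e * y + algebraMap K E f) /
            algebraMap K E d := by
          rw [eq_div_iff hd']
          simp only [map_zero] at h
          linear_combination h
        rw [this]
        have h1 := mem_adjoin_simple_self K y
        exact div_mem (neg_mem (add_mem (add_mem (mul_mem (_root_.algebraMap_mem _ _)
          (pow_mem h1 2)) (mul_mem (_root_.algebraMap_mem _ _) h1))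
          (_root_.algebraMap_mem _ _))) (_root_.algebraMap_mem _ _)
    · exact main (t := -c / b) (by subst ha; field_simp; ring) (Or.inr hb)
  · obtain ⟨t, ht⟩ := IsAlgClosed.exists_root
      (Polynomial.C a * .X ^ 2 + Polynomial.C b * .X + Polynomial.C c)
      (by rw [Polynomial.degree_quadratic ha]; decide)
    exact main (t := t) (by simpa using ht) (Or.inl ha)

open Polynomial in
lemma finrank_adjoin_mul_le_two {x y : E} (hgen : K⟮x, y⟯ = ⊤) (hv : Transcendental K (x * y))
    {p q r s t u : K} (hp : p ≠ 0)
    (h : algebraMap K E p * x ^ 2 * y + algebraMap K E q * x * y ^ 2 + algebraMap K E r * x * y +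
      algebraMap K E s * x + algebraMap K E t * y + algebraMap K E u = 0) :
    Module.finrank K⟮x * y⟯ E ≤ 2 := by
  set v := x * y with hvd
  set V : K⟮v⟯ := AdjoinSimple.gen K v
  set c := algebraMap K K⟮v⟯
  have hx0 : x ≠ 0 := by
    rintro rfl
    exact hv (by rw [hvd, zero_mul]; exact isAlgebraic_zero)
  let Q : K⟮v⟯[X] := C (c p * V + c s) * X ^ 2 + C (c r * V + c u) * X + C (c q * V ^ 2 + c t * V)
  have hlead : c p * V + c s ≠ 0 := by
    intro h0
    have h1 := congr_arg (algebraMap K⟮v⟯ E) h0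
    have : (C p * X + C s : K[X]) = 0 := by
      refine (transcendental_iff.1 hv) _ ?_
      simp only [map_add, map_mul, aeval_C, aeval_X]
      exact h1
    exact hp (by simpa using congr_arg (fun p => p.coeff 1) this)
  have hQ0 : Q ≠ 0 := by
    intro h0
    have := degree_quadratic (b := c r * V + c u) (c := c q * V ^ 2 + c t * V) hlead
    rw [show C (c p * V + c s) * X ^ 2 + _ + _ = Q from rfl, h0] at this
    simp at this
  have hQx : aeval x Q = 0 := by
    have : aeval x Q = x * (algebraMap K E p * x ^ 2 * y + algebraMap K E q * x * y ^ 2 +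
      algebraMap K E r * x * y +
      algebraMap K E s * x + algebraMap K E t * y + algebraMap K E u) := by
      simp only [Q, map_add, map_mul, aeval_C, aeval_X, map_pow]
      have h1 : algebraMap K⟮v⟯ E V = x * y := rfl
      have h2 (k) : algebraMap K⟮v⟯ E (c k) = algebraMap K E k := rfl
      simp only [h1, h2]
      ring
    rw [this, h, mul_zero]
  have hint : IsIntegral K⟮v⟯ x := isAlgebraic_iff_isIntegral.1 ⟨Q, hQ0, hQx⟩
  have htop : K⟮v⟯⟮x⟯ = ⊤ := by
    rw [← restrictScalars_eq_top_iff (K := K), _root_.eq_top_iff, ← hgen, adjoin_le_iff]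
    have hx : x ∈ K⟮v⟯⟮x⟯.restrictScalars K := mem_adjoin_simple_self K⟮v⟯ x
    have hv : v ∈ K⟮v⟯⟮x⟯.restrictScalars K := _root_.algebraMap_mem K⟮v⟯⟮x⟯ V
    rintro z (rfl | rfl)
    · exact hx
    · have := div_mem hv hx
      rwa [hvd, mul_div_cancel_left₀ _ hx0] at this
  rw [← IntermediateField.finrank_top', ← htop, adjoin.finrank hint]
  refine (natDegree_le_of_dvd (minpoly.dvd _ _ hQx) hQ0).trans ?_
  exact natDegree_quadratic_le

end Curves

section Descent

variable {K E Γ : Type*} [Field K] [Field E] [Algebra K E] [LinearOrderedCommGroupWithZero Γ]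
  (v : Valuation E Γ)

lemma Valuation.map_algebraMap_le_one (hK : ∀ c : K, c ≠ 0 → v (algebraMap K E c) = 1) (c : K) :
    v (algebraMap K E c) ≤ 1 := by
  by_cases h : c = 0
  · simp [h]
  · exact (hK c h).le

lemma Valuation.map_add_algebraMap (hK : ∀ c : K, c ≠ 0 → v (algebraMap K E c) = 1) {x : E}
    (hx : 1 < v x) (c : K) : v (x + algebraMap K E c) = v x :=
  v.map_add_eq_of_lt_left ((v.map_algebraMap_le_one hK c).trans_lt hx)

lemma Valuation.exists_one_lt_adjoin_eq
    (hres : ∀ z : E, v z ≤ 1 → ∃ c : K, v (z - algebraMap K E c) < 1) {f : E}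
    (hf : Transcendental K f) : ∃ g : E, 1 < v g ∧ K⟮g⟯ = K⟮f⟯ := by
  rcases lt_or_ge 1 (v f) with h | h
  · exact ⟨f, h, rfl⟩
  obtain ⟨c, hc⟩ := hres f h
  have h0 : f - algebraMap K E c ≠ 0 := by
    intro h0
    rw [sub_eq_zero] at h0
    exact hf (h0 ▸ isAlgebraic_algebraMap c)
  refine ⟨(f - algebraMap K E c)⁻¹, ?_, le_antisymm ?_ ?_⟩
  · rw [map_inv₀]
    exact (one_lt_inv₀ ((Valuation.pos_iff v).2 h0)).2 hc
  · rw [adjoin_simple_le_iff]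
    exact inv_mem (sub_mem (mem_adjoin_simple_self K f) (_root_.algebraMap_mem _ _))
  · rw [adjoin_simple_le_iff]
    have := add_mem (inv_mem (mem_adjoin_simple_self K (f - algebraMap K E c)⁻¹))
      (_root_.algebraMap_mem K⟮(f - algebraMap K E c)⁻¹⟯ c)
    simpa using this

lemma Valuation.exists_parameter_or_exists_cubic [IsAlgClosed K]
    (hK : ∀ c : K, c ≠ 0 → v (algebraMap K E c) = 1) {x y : E} (hx : 1 < v x) (hxy : v x = v y)
    [FiniteDimensional K⟮x⟯ E] [FiniteDimensional K⟮y⟯ E]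
    (hm : Module.finrank K⟮x⟯ E ≤ 2) (hn : Module.finrank K⟮y⟯ E ≤ 2)
    (hxmem : x ∉ K⟮y⟯) (hymem : y ∉ K⟮x⟯) :
    (∃ w : E, K⟮w⟯ = ⊤) ∨ ∃ h : ℕ → ℕ → K, h 2 1 ≠ 0 ∧ h 1 2 ≠ 0 ∧ h 2 2 = 0 ∧
      ∑ i ∈ Finset.range 3, ∑ j ∈ Finset.range 3,
        algebraMap K E (h i j) * x ^ i * y ^ j = 0 := by
  obtain ⟨h, hne, hrel⟩ := exists_biquadratic_relation
    (v.transcendental_of_one_lt hK (hx.trans_eq hxy)) hm hn hxmem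
  have hx0 : 0 < v x := zero_lt_one.trans hx
  have bound (i j : ℕ) {n : ℕ} (hij : i + j ≤ n) :
      v (algebraMap K E (h i j) * x ^ i * y ^ j) ≤ v x ^ n := by
    rw [map_mul, map_mul, map_pow, map_pow, ← hxy, mul_assoc, ← pow_add]
    exact (mul_le_of_le_one_left' (v.map_algebraMap_le_one hK _)).trans
      (pow_le_pow_right₀ hx.le hij)
  have exact_value (i j : ℕ) (hij : h i j ≠ 0) :
      v (algebraMap K E (h i j) * x ^ i * y ^ j) = v x ^ (i + j) := by
    rw [map_mul, map_mul, map_pow, map_pow, ← hxy, mul_assoc, ← pow_add, hK _ hij, one_mul]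
  simp only [Finset.sum_range_succ, Finset.sum_range_zero, zero_add] at hrel
  set q := algebraMap K E (h 0 0) * x ^ 0 * y ^ 0 + algebraMap K E (h 0 1) * x ^ 0 * y ^ 1 +
    algebraMap K E (h 0 2) * x ^ 0 * y ^ 2 + algebraMap K E (h 1 0) * x ^ 1 * y ^ 0 +
    algebraMap K E (h 1 1) * x ^ 1 * y ^ 1 + algebraMap K E (h 2 0) * x ^ 2 * y ^ 0 with hq
  have hqv : v q ≤ v x ^ 2 := by
    repeat' apply v.map_add_le
    all_goals exact bound _ _ (by norm_num)
  have h22 : h 2 2 = 0 := by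
    by_contra h0
    have h1 := exact_value 2 2 h0
    have h2 : algebraMap K E (h 2 2) * x ^ 2 * y ^ 2 =
        -(q + algebraMap K E (h 2 1) * x ^ 2 * y ^ 1 + algebraMap K E (h 1 2) * x ^ 1 * y ^ 2) := by
      linear_combination hrel
    have h3 : v x ^ (2 + 2) ≤ v x ^ 3 := by
      rw [← h1, h2, Valuation.map_neg]
      exact v.map_add_le (v.map_add_le (hqv.trans (pow_le_pow_right₀ hx.le (by norm_num)))
        (bound _ _ le_rfl)) (bound _ _ le_rfl)
    exact absurd h3 (not_le.2 (pow_lt_pow_right₀ hx (by norm_num)))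
  have h3 : algebraMap K E (h 2 1) * x ^ 2 * y ^ 1 + algebraMap K E (h 1 2) * x ^ 1 * y ^ 2 =
      -q := by
    rw [h22, map_zero] at hrel
    linear_combination hrel
  have hlt : v x ^ 2 < v x ^ 3 := pow_lt_pow_right₀ hx (by norm_num)
  by_cases h21 : h 2 1 = 0 <;> by_cases h12 : h 1 2 = 0
  · left
    have h0 : h 2 0 ≠ 0 ∨ h 1 1 ≠ 0 ∨ h 0 2 ≠ 0 ∨ h 1 0 ≠ 0 ∨ h 0 1 ≠ 0 ∨ h 0 0 ≠ 0 := by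
      by_contra! hc
      obtain ⟨i, hi, j, hj, hij⟩ := hne
      apply hij
      interval_cases i <;> interval_cases j <;> tauto
    rw [h21, h12] at h3
    simp only [map_zero, zero_mul, zero_add] at h3
    rw [hq] at h3
    obtain ⟨w, hxw, hyw⟩ := exists_conic_parameter hxmem hymem h0 (by linear_combination h3)
    refine ⟨w, ?_⟩
    rw [_root_.eq_top_iff, ← adjoin_pair_eq_top_of_finrank_le_two hm hymem, adjoin_le_iff]
    rintro z (rfl | rfl)
    exacts [hxw, hyw]
  · have h1 := exact_value 1 2 h12
    rw [h21] at h3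
    simp only [map_zero, zero_mul, zero_add] at h3
    rw [h3, Valuation.map_neg] at h1
    exact absurd (h1 ▸ hqv) (not_le.2 hlt)
  · have h1 := exact_value 2 1 h21
    rw [h12] at h3
    simp only [map_zero, zero_mul, add_zero] at h3
    rw [h3, Valuation.map_neg] at h1
    exact absurd (h1 ▸ hqv) (not_le.2 hlt)
  · right
    refine ⟨h, h21, h12, h22, ?_⟩
    simp only [Finset.sum_range_succ, Finset.sum_range_zero, zero_add]
    exact hrel

lemma Valuation.exists_finrank_adjoin_le_two_of_cubic
    (hK : ∀ c : K, c ≠ 0 → v (algebraMap K E c) = 1) {x y : E} (hx : 1 < v x) (hxy : v x = v y)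
    (hgen : K⟮x, y⟯ = ⊤) {h : ℕ → ℕ → K} (h21 : h 2 1 ≠ 0) (h12 : h 1 2 ≠ 0) (h22 : h 2 2 = 0)
    (hrel : ∑ i ∈ Finset.range 3, ∑ j ∈ Finset.range 3,
        algebraMap K E (h i j) * x ^ i * y ^ j = 0) :
    ∃ w : E, v w = v x ^ 2 ∧ Module.finrank K⟮w⟯ E ≤ 2 := by
  obtain ⟨β, hβ⟩ : ∃ β, h 2 0 = h 2 1 * β := ⟨h 2 0 / h 2 1, by field_simp⟩
  obtain ⟨α, hα⟩ : ∃ α, h 0 2 = h 1 2 * α := ⟨h 0 2 / h 1 2, by field_simp⟩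
  have hval : v ((x + algebraMap K E α) * (y + algebraMap K E β)) = v x ^ 2 := by
    rw [map_mul, v.map_add_algebraMap hK hx, v.map_add_algebraMap hK (hxy ▸ hx), ← hxy, sq]
  refine ⟨(x + algebraMap K E α) * (y + algebraMap K E β), hval, ?_⟩
  refine finrank_adjoin_mul_le_two ?_ (v.transcendental_of_one_lt hK ?_) h21 (q := h 1 2)
    (r := h 1 1 - 2 * α * h 2 1 - 2 * β * h 1 2) (s := h 1 0 - β * h 1 1 + h 1 2 * β ^ 2)
    (t := h 0 1 - α * h 1 1 + h 2 1 * α ^ 2)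
    (u := h 0 0 + α * β * h 1 1 - α * h 1 0 - β * h 0 1) ?_
  · rw [_root_.eq_top_iff, ← hgen, adjoin_le_iff]
    have hmem (z : E) (c : K) (hz : z + algebraMap K E c ∈
        K⟮x + algebraMap K E α, y + algebraMap K E β⟯) :
        z ∈ K⟮x + algebraMap K E α, y + algebraMap K E β⟯ := by
      simpa using sub_mem hz (IntermediateField.algebraMap_mem _ c)
    rintro z (rfl | rfl)
    · exact hmem _ α (subset_adjoin _ _ (by simp))
    · exact hmem _ β (subset_adjoin _ _ (by simp))
  · rw [hval]
    exact one_lt_pow₀ hx (by norm_num)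
  · simp only [Finset.sum_range_succ, Finset.sum_range_zero, zero_add, h22, hα, hβ, map_mul,
      map_zero] at hrel
    simp only [map_add, _root_.map_sub, map_mul, map_pow, map_ofNat]
    linear_combination hrel

lemma Valuation.false_of_even_pole
    (hK : ∀ c : K, c ≠ 0 → v (algebraMap K E c) = 1) {x y z : E} (hz : 1 < v z)
    (hx : v x = v z ^ 2) (hxy : v x = v y) [FiniteDimensional K⟮x⟯ E]
    (hm : Module.finrank K⟮x⟯ E ≤ 2) (hymem : y ∉ K⟮x⟯)
    {h : ℕ → ℕ → K} (h12 : h 1 2 ≠ 0) (h22 : h 2 2 = 0)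
    (hrel : ∑ i ∈ Finset.range 3, ∑ j ∈ Finset.range 3,
        algebraMap K E (h i j) * x ^ i * y ^ j = 0) : False := by
  have hz0 : v z ≠ 0 := (zero_lt_one.trans hz).ne'
  have hx1 : 1 < v x := hx ▸ one_lt_pow₀ hz (by norm_num)
  have hxmem := mem_adjoin_simple_self K x
  have heven {a : E} (ha : a ∈ K⟮x⟯) (ha0 : a ≠ 0) : ∃ n : ℤ, v a = v z ^ (2 * n) := by
    obtain ⟨n, hn⟩ := v.exists_zpow_of_mem_adjoin hK hx1 ha ha0
    refine ⟨n, ?_⟩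
    rw [hn, hx, zpow_mul, zpow_ofNat]
  have hodd {a b : E} (ha : a ∈ K⟮x⟯) (hb : b ∈ K⟮x⟯) (hb0 : b ≠ 0) : v a ≠ v (b * z) := by
    intro hab
    have ha0 : a ≠ 0 := by
      rintro rfl
      rw [map_zero, eq_comm, Valuation.zero_iff, mul_eq_zero] at hab
      rcases hab with rfl | rfl
      · exact hb0 rfl
      · exact hz0 (map_zero v)
    obtain ⟨n, hn⟩ := heven ha ha0
    obtain ⟨m, hm⟩ := heven hb hb0
    rw [map_mul, hn, hm, ← zpow_add_one₀ hz0] at hab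
    have := zpow_right_injective₀ (zero_lt_one.trans hz) hz.ne' hab
    omega
  have hzmem : z ∉ K⟮x⟯ := fun hmem => hodd hmem (one_mem _) one_ne_zero (by rw [one_mul])
  obtain ⟨a, ha, b, hb, rfl⟩ : ∃ a ∈ K⟮x⟯, ∃ b ∈ K⟮x⟯, y = a + b * z := by
    have h1 : ¬ LinearIndependent K⟮x⟯ ![1, z, y] := by
      intro h
      have := h.fintype_card_le_finrank
      simp at this
      omega
    rw [Fintype.not_linearIndependent_iff] at h1
    obtain ⟨g, hg, hg0⟩ := h1
    simp only [Fin.sum_univ_three, Matrix.cons_val, IntermediateField.smul_def, smul_eq_mul] at hg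
    by_cases hg2 : g 2 = 0
    · by_cases hg1 : g 1 = 0
      · have : g 0 = 0 := by
          rw [hg1, hg2] at hg
          simpa using hg
        obtain ⟨i, hi⟩ := hg0
        fin_cases i <;> tauto
      · refine (hzmem ?_).elim
        have h1 : (g 1 : E) ≠ 0 := by simpa using hg1
        have : z = -(g 0 : E) / g 1 := by
          rw [eq_div_iff h1]
          rw [hg2] at hg
          simp only [ZeroMemClass.coe_zero] at hg
          linear_combination hg
        rw [this]
        exact div_mem (neg_mem (g 0).2) (g 1).2
    · have h2 : (g 2 : E) ≠ 0 := by simpa using hg2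
      refine ⟨-(g 0 : E) / g 2, div_mem (neg_mem (g 0).2) (g 2).2, -(g 1 : E) / g 2,
        div_mem (neg_mem (g 1).2) (g 2).2, ?_⟩
      field_simp
      linear_combination hg
  have hb0 : b ≠ 0 := by
    rintro rfl
    exact hymem (by simpa using ha)
  have hlt : v (b * z) < v a := by
    by_contra! hle
    have h1 := v.map_add_eq_of_lt_right (hle.lt_of_ne (hodd ha hb hb0))
    rw [h1] at hxy
    exact hodd hxmem hb hb0 hxy
  have hav : v x = v a := hxy.trans (v.map_add_eq_of_lt_left hlt)
  set y := a + b * z with hy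
  simp only [Finset.sum_range_succ, Finset.sum_range_zero, zero_add, h22, map_zero, zero_mul,
    add_zero, pow_zero, mul_one, pow_one] at hrel
  obtain ⟨p, hp⟩ : ∃ p, p = algebraMap K E (h 1 2) * x + algebraMap K E (h 0 2) := ⟨_, rfl⟩
  obtain ⟨q, hq⟩ : ∃ q, q = algebraMap K E (h 2 1) * x ^ 2 + algebraMap K E (h 1 1) * x +
    algebraMap K E (h 0 1) := ⟨_, rfl⟩
  obtain ⟨r, hr⟩ : ∃ r, r = algebraMap K E (h 2 0) * x ^ 2 + algebraMap K E (h 1 0) * x +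
    algebraMap K E (h 0 0) := ⟨_, rfl⟩
  have hc (c : K) : algebraMap K E c ∈ K⟮x⟯ := IntermediateField.algebraMap_mem _ c
  have hpm : p ∈ K⟮x⟯ := hp ▸ add_mem (mul_mem (hc _) hxmem) (hc _)
  have hqm : q ∈ K⟮x⟯ := hq ▸ add_mem (add_mem (mul_mem (hc _) (pow_mem hxmem 2))
    (mul_mem (hc _) hxmem)) (hc _)
  have hrm : r ∈ K⟮x⟯ := hr ▸ add_mem (add_mem (mul_mem (hc _) (pow_mem hxmem 2))
    (mul_mem (hc _) hxmem)) (hc _)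
  have hrel' : p * y ^ 2 + q * y + r = 0 := by
    rw [hp, hq, hr]
    linear_combination hrel
  have hpv : v p = v x := by
    have : v (algebraMap K E (h 1 2) * x) = v x := by rw [map_mul, hK _ h12, one_mul]
    rw [hp, v.map_add_algebraMap hK (this ▸ hx1), this]
  have hrv : v r ≤ v x ^ 2 := by
    have h1 := v.map_algebraMap_le_one hK
    rw [hr]
    refine v.map_add_le (v.map_add_le ?_ ?_) ((h1 _).trans (one_le_pow₀ hx1.le))
    · rw [map_mul, map_pow]
      exact mul_le_of_le_one_left' (h1 _)
    · rw [map_mul]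
      exact (mul_le_of_le_one_left' (h1 _)).trans (le_self_pow₀ hx1.le (by norm_num))
  have hx0 : 0 < v x := zero_lt_one.trans hx1
  have hy0 : y ≠ 0 := by
    intro h0
    rw [h0, map_zero] at hxy
    exact hx0.ne' hxy
  have hpa : v (p * a) = v x ^ 2 := by rw [map_mul, hpv, ← hav, sq]
  have hDv : v (2 * p * a + q) = v x ^ 2 := by
    have h1 : 2 * p * a + q = p * a + -(p * (b * z) + r / y) := by
      field_simp
      linear_combination hrel' - p * y * hy
    have h2 : v (-(p * (b * z) + r / y)) < v (p * a) := by
      rw [Valuation.map_neg, hpa]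
      refine v.map_add_lt ?_ ?_
      · rw [map_mul, hpv, sq]
        exact mul_lt_mul_of_pos_left (hav ▸ hlt) hx0
      · rw [map_div₀, ← hxy, div_lt_iff₀ hx0]
        exact hrv.trans_lt (lt_mul_of_one_lt_right (pow_pos hx0 2) hx1)
    rw [h1, v.map_add_eq_of_lt_left h2, hpa]
  have hbz0 : 0 < v (b * z) := by
    rw [map_mul]
    exact mul_pos ((Valuation.pos_iff v).2 hb0) (zero_lt_one.trans hz)
  have h1 : p * a ^ 2 + q * a + r = -((2 * p * a + q) * (b * z) + p * (b * z) ^ 2) := by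
    linear_combination hrel' - (p * (y + a + b * z) + q) * hy
  have h2 : v (p * (b * z) ^ 2) < v ((2 * p * a + q) * (b * z)) := by
    rw [map_mul _ _ (b * z), hDv, map_mul, map_pow, hpv, sq, sq, mul_assoc]
    exact mul_lt_mul_of_pos_left (mul_lt_mul_of_pos_right (hav ▸ hlt) hbz0) hx0
  have h3 : v (p * a ^ 2 + q * a + r) = v ((2 * p * a + q) * b * z) := by
    rw [h1, Valuation.map_neg, v.map_add_eq_of_lt_left h2, mul_assoc (2 * p * a + q)]
  refine hodd ?_ ?_ ?_ h3
  · exact add_mem (add_mem (mul_mem hpm (pow_mem ha 2)) (mul_mem hqm ha)) hrm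
  · exact mul_mem (add_mem (mul_mem (mul_mem (by exact ofNat_mem _ 2) hpm) ha) hqm) hb
  · refine mul_ne_zero (fun h0 => ?_) hb0
    rw [h0, map_zero] at hDv
    exact (pow_pos hx0 2).ne hDv

end Descent

section Stable

variable {K E Γ : Type*} [Field K] [Field E] [Algebra K E] [LinearOrderedCommGroupWithZero Γ]
  (v : Valuation E Γ)

lemma Valuation.exists_stable_of_adjoin_eq_top
    (hres : ∀ z : E, v z ≤ 1 → ∃ c : K, v (z - algebraMap K E c) < 1)
    {f w : E} (hf : Transcendental K f) [FiniteDimensional K⟮f⟯ E] (hw : K⟮w⟯ = ⊤) :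
    ∃ g : E, 1 < v g ∧ Module.finrank K⟮g⟯ E ≤ Module.finrank K⟮f⟯ E ∧ K⟮g⟯ = ⊤ := by
  have hwt : Transcendental K w := by
    intro h
    have := isAlgebraic_adjoin_simple h.isIntegral
    have hfw : f ∈ K⟮w⟯ := hw ▸ mem_top
    have h1 := Algebra.IsAlgebraic.isAlgebraic (R := K) (⟨f, hfw⟩ : K⟮w⟯)
    exact hf (h1.algebraMap (A := E))
  obtain ⟨g, hg, hgw⟩ := v.exists_one_lt_adjoin_eq hres hwt
  refine ⟨g, hg, ?_, hgw.trans hw⟩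
  rw [hgw, hw, IntermediateField.finrank_top]
  exact Module.finrank_pos

lemma Valuation.exists_stable [IsAlgClosed K]
    (hK : ∀ c : K, c ≠ 0 → v (algebraMap K E c) = 1)
    (hres : ∀ z : E, v z ≤ 1 → ∃ c : K, v (z - algebraMap K E c) < 1)
    (hfin : ∀ f : E, Transcendental K f → FiniteDimensional K⟮f⟯ E)
    {ι : Type*} (act : ι → E → E) (hactv : ∀ σ z, v (act σ z) = v z)
    (hactd : ∀ σ z, Module.finrank K⟮act σ z⟯ E = Module.finrank K⟮z⟯ E)
    {f : E} (hf : Transcendental K f) (hd : Module.finrank K⟮f⟯ E ≤ 2) :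
    ∃ g : E, 1 < v g ∧ Module.finrank K⟮g⟯ E ≤ Module.finrank K⟮f⟯ E ∧
      ∀ σ, act σ g ∈ K⟮g⟯ := by
  have := hfin f hf
  by_cases hrat : ∃ w : E, K⟮w⟯ = ⊤
  · obtain ⟨w, hw⟩ := hrat
    obtain ⟨g, hg, hgd, hgt⟩ := v.exists_stable_of_adjoin_eq_top hres hf hw
    exact ⟨g, hg, hgd, fun σ => hgt ▸ mem_top⟩
  obtain ⟨x, hx, hxf⟩ := v.exists_one_lt_adjoin_eq hres hf
  have hd2 : Module.finrank K⟮f⟯ E = 2 := by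
    have h1 : Module.finrank K⟮f⟯ E ≠ 1 := fun h1 =>
      hrat ⟨f, by rwa [IntermediateField.finrank_eq_one_iff_eq_top] at h1⟩
    have h2 : 0 < Module.finrank K⟮f⟯ E := Module.finrank_pos
    omega
  have cubic {x : E} (hx : 1 < v x) (hxd : Module.finrank K⟮x⟯ E ≤ 2) {σ : ι}
      (hσ : act σ x ∉ K⟮x⟯) : K⟮x, act σ x⟯ = ⊤ ∧
      ∃ h : ℕ → ℕ → K, h 2 1 ≠ 0 ∧ h 1 2 ≠ 0 ∧ h 2 2 = 0 ∧
        ∑ i ∈ Finset.range 3, ∑ j ∈ Finset.range 3,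
          algebraMap K E (h i j) * x ^ i * act σ x ^ j = 0 := by
    have := hfin x (v.transcendental_of_one_lt hK hx)
    have := hfin (act σ x) (v.transcendental_of_one_lt hK (by rwa [hactv]))
    have hσ' : x ∉ K⟮act σ x⟯ := by
      intro hmem
      have := eq_of_le_of_finrank_eq' (adjoin_simple_le_iff.2 hmem) (hactd σ x).symm
      exact hσ (this ▸ mem_adjoin_simple_self K _)
    exact ⟨adjoin_pair_eq_top_of_finrank_le_two hxd hσ,
      (v.exists_parameter_or_exists_cubic hK hx (hactv σ x).symm hxd
        ((hactd σ x).trans_le hxd) hσ' hσ).resolve_left hrat⟩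
  have hxd : Module.finrank K⟮x⟯ E ≤ 2 := by rwa [hxf]
  by_cases hst : ∀ σ, act σ x ∈ K⟮x⟯
  · exact ⟨x, hx, by rw [hxf], hst⟩
  push Not at hst
  obtain ⟨σ, hσ⟩ := hst
  obtain ⟨htop, h, h21, h12, h22, hrel⟩ := cubic hx hxd hσ
  obtain ⟨w, hw, hwd⟩ := v.exists_finrank_adjoin_le_two_of_cubic hK hx (hactv σ x).symm htop
    h21 h12 h22 hrel
  have hw1 : 1 < v w := hw ▸ one_lt_pow₀ hx two_ne_zero
  refine ⟨w, hw1, hd2 ▸ hwd, ?_⟩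
  by_contra! hst
  obtain ⟨τ, hτ⟩ := hst
  obtain ⟨-, h, -, h12, h22, hrel⟩ := cubic hw1 hwd hτ
  have := hfin w (v.transcendental_of_one_lt hK hw1)
  exact v.false_of_even_pole hK hx hw (hactv τ w).symm hwd hτ h12 h22 hrel

end Stable

section BaseChange

open scoped algebraAdjoinAdjoin in
lemma IsFunctionField.finiteDimensional_adjoin {k F : Type*} [Field k] [Field F] [Algebra k F]
    (hF : IsFunctionField k F) {f : F} (hf : Transcendental k f) : FiniteDimensional k⟮f⟯ F := by
  obtain ⟨x, hx, hfin⟩ := hF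
  have halgx : Algebra.IsAlgebraic (Algebra.adjoin k {x}) F :=
    (IsFractionRing.comap_isAlgebraic_iff (K := k⟮x⟯)).2 inferInstance
  have htr : Algebra.trdeg k F ≤ Cardinal.mk ({f} : Set F) := by
    simpa using Algebra.IsAlgebraic.trdeg_le_cardinalMk (R := k) {x}
  have halg : Algebra.IsAlgebraic k⟮f⟯ F := by
    have h1 : IsTranscendenceBasis k (Subtype.val : ({f} : Set F) → F) :=
      (algebraicIndependent_unique_type_iff.2 hf).isTranscendenceBasis_of_trdeg_le_of_finite htr
    have := h1.isAlgebraic_field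
    rwa [Subtype.range_coe] at this
  have h1 : FiniteDimensional k⟮f⟯ k⟮f⟯⟮x⟯ :=
    adjoin.finiteDimensional (Algebra.IsAlgebraic.isAlgebraic x).isIntegral
  have hle : k⟮x⟯ ≤ k⟮f⟯⟮x⟯.restrictScalars k :=
    adjoin_simple_le_iff.2 (mem_adjoin_simple_self _ x)
  have h2 : FiniteDimensional k⟮f⟯⟮x⟯ F := by
    let : Algebra k⟮x⟯ k⟮f⟯⟮x⟯ := (inclusion hle).toRingHom.toAlgebra
    have : IsScalarTower k⟮x⟯ k⟮f⟯⟮x⟯ F := IsScalarTower.of_algebraMap_eq fun _ => rfl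
    exact Module.Finite.of_restrictScalars_finite k⟮x⟯ _ _
  exact Module.Finite.trans k⟮f⟯⟮x⟯ F

variable {k F K E : Type*} [Field k] [Field F] [Field K] [Field E] [Algebra k F] [Algebra k K]
  [Algebra k E] [Algebra F E] [Algebra K E] [IsScalarTower k F E] [IsScalarTower k K E]

lemma transcendental_algebraMap_of_isAlgebraic [Algebra.IsAlgebraic k K] {f : F}
    (hf : Transcendental k f) : Transcendental K (algebraMap F E f) :=
  ((transcendental_algebraMap_iff (algebraMap F E).injective).2 hf).extendScalars K

lemma algebraMap_mem_adjoin_of_mem_adjoin {f c : F} (hc : c ∈ k⟮f⟯) :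
    algebraMap F E c ∈ K⟮algebraMap F E f⟯ := by
  have : k⟮f⟯ ≤ (K⟮algebraMap F E f⟯.restrictScalars k).comap (IsScalarTower.toAlgHom k F E) :=
    adjoin_simple_le_iff.2 (mem_adjoin_simple_self K (algebraMap F E f))
  exact this hc

lemma span_range_algebraMap_comp_eq_top {f : F}
    (hspan : Submodule.span K (Set.range (algebraMap F E)) = ⊤)
    {ι : Type*} (b : Module.Basis ι k⟮f⟯ F) :
    Submodule.span K⟮algebraMap F E f⟯ (Set.range (algebraMap F E ∘ b)) = ⊤ := by
  set S := Submodule.span K⟮algebraMap F E f⟯ (Set.range (algebraMap F E ∘ b)) with hS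
  have hF (y : F) : algebraMap F E y ∈ S := by
    induction b.mem_span y using Submodule.span_induction with
    | mem y hy =>
      obtain ⟨i, rfl⟩ := hy
      exact Submodule.subset_span ⟨i, rfl⟩
    | zero => simp
    | add y z _ _ hy hz => rw [map_add]; exact add_mem hy hz
    | smul c y _ hy =>
      rw [IntermediateField.smul_def, smul_eq_mul, map_mul]
      exact S.smul_mem ⟨_, algebraMap_mem_adjoin_of_mem_adjoin (K := K) c.2⟩ hy
  rw [_root_.eq_top_iff]
  rintro x -
  have hx : x ∈ Submodule.span K (Set.range (algebraMap F E)) := hspan ▸ Submodule.mem_top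
  induction hx using Submodule.span_induction with
  | mem y hy =>
    obtain ⟨y, rfl⟩ := hy
    exact hF y
  | zero => simp
  | add y z _ _ hy hz => exact add_mem hy hz
  | smul c y _ hy =>
    have := S.smul_mem (algebraMap K _ c) hy
    rwa [algebraMap_smul] at this

lemma finiteDimensional_adjoin_algebraMap {f : F} [FiniteDimensional k⟮f⟯ F]
    (hspan : Submodule.span K (Set.range (algebraMap F E)) = ⊤) :
    FiniteDimensional K⟮algebraMap F E f⟯ E :=
  ⟨span_range_algebraMap_comp_eq_top hspan (Module.finBasis k⟮f⟯ F) ▸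
    Submodule.fg_span (Set.finite_range _)⟩

lemma finrank_adjoin_algebraMap_le {f : F} [FiniteDimensional k⟮f⟯ F]
    (hspan : Submodule.span K (Set.range (algebraMap F E)) = ⊤) :
    Module.finrank K⟮algebraMap F E f⟯ E ≤ Module.finrank k⟮f⟯ F := by
  have h := finrank_range_le_card (R := K⟮algebraMap F E f⟯)
    (algebraMap F E ∘ Module.finBasis k⟮f⟯ F)
  rwa [Set.finrank, span_range_algebraMap_comp_eq_top hspan, finrank_top, Fintype.card_fin] at h

open Polynomial in
open scoped algebraAdjoinAdjoin in
lemma linearIndependent_adjoin_simple {x : E} {ι : Type*} [Fintype ι] {y : ι → E}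
    (h : LinearIndependent K (fun p : ℕ × ι => x ^ p.1 * y p.2)) : LinearIndependent K⟮x⟯ y := by
  rw [← LinearIndependent.iff_fractionRing (R := Algebra.adjoin K {x}),
    Fintype.linearIndependent_iff]
  intro g hg i
  have hp (j) : ∃ p : K[X], aeval x p = (g j : E) :=
    (Algebra.adjoin_singleton_eq_range_aeval K _).le (g j).2
  choose p hp using hp
  obtain ⟨N, hN⟩ : ∃ N, ∀ j, (p j).natDegree < N :=
    ⟨Finset.univ.sup (fun j => (p j).natDegree) + 1, fun j => Nat.lt_succ_of_le
      (Finset.le_sup (f := fun j => (p j).natDegree) (Finset.mem_univ j))⟩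
  rw [linearIndependent_iff'] at h
  have h0 : p i = 0 := by
    ext n
    by_cases hn : n < N
    · refine h (Finset.range N ×ˢ Finset.univ) (fun q => (p q.2).coeff q.1) ?_ (n, i)
        (by simpa using hn)
      rw [Finset.sum_product_right, ← hg]
      refine Finset.sum_congr rfl fun j _ => ?_
      rw [Algebra.smul_def, Subalgebra.algebraMap_def, ← hp, aeval_eq_sum_range' (hN j),
        Algebra.algebraMap_self_apply, Finset.sum_mul]
      exact Finset.sum_congr rfl fun m _ => (smul_mul_assoc _ _ _).symm
    · rw [coeff_zero, coeff_eq_zero_of_natDegree_lt ((hN i).trans_le (not_lt.1 hn))]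
  ext
  rw [← hp, h0, map_zero]
  rfl

open Polynomial in
lemma finrank_le_finrank_adjoin_algebraMap {k F K E : Type*} [Field k] [Field F] [Field K]
    [Field E] [Algebra k F] [Algebra F E] [Algebra K E] {f : F} (hf : Transcendental k f)
    [FiniteDimensional k⟮f⟯ F] [FiniteDimensional K⟮algebraMap F E f⟯ E]
    (hli : ∀ {ι : Type} (y : ι → F), LinearIndependent k y →
      LinearIndependent K (algebraMap F E ∘ y)) :
    Module.finrank k⟮f⟯ F ≤ Module.finrank K⟮algebraMap F E f⟯ E := by
  have hpow : LinearIndependent k (fun n : ℕ => AdjoinSimple.gen k f ^ n) := by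
    have h := (basisMonomials k).linearIndependent.map' (aeval f).toLinearMap
      (LinearMap.ker_eq_bot.2 (transcendental_iff_injective.1 hf))
    refine LinearIndependent.of_comp k⟮f⟯.val.toLinearMap ?_
    have hcomp : k⟮f⟯.val.toLinearMap ∘ (fun n : ℕ => AdjoinSimple.gen k f ^ n) =
        (aeval f).toLinearMap ∘ basisMonomials k := by
      ext n
      simp
    rw [hcomp]
    exact h
  set b := Module.finBasis k⟮f⟯ F
  have h1 := hli _ (linearIndependent_smul hpow b.linearIndependent)
  have h2 : LinearIndependent K⟮algebraMap F E f⟯ (algebraMap F E ∘ b) := by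
    refine linearIndependent_adjoin_simple (Eq.mp ?_ h1)
    congr 1
    ext p
    simp [IntermediateField.smul_def]
  simpa using h2.fintype_card_le_finrank

lemma gonality_le_finrank {k F : Type*} [Field k] [Field F] [Algebra k F] {f : F}
    (hf : Transcendental k f) : gonality k F ≤ Module.finrank k⟮f⟯ F :=
  Nat.sInf_le ⟨f, hf, rfl⟩

lemma IsFunctionField.exists_finrank_eq_gonality {k F : Type*} [Field k] [Field F] [Algebra k F]
    (hF : IsFunctionField k F) :
    ∃ f : F, Transcendental k f ∧ Module.finrank k⟮f⟯ F = gonality k F := by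
  obtain ⟨x, hx, -⟩ := hF
  exact Nat.sInf_mem (s := {d : ℕ | ∃ f : F, Transcendental k f ∧
    Module.finrank k⟮f⟯ F = d}) ⟨_, x, hx, rfl⟩

lemma IsFunctionField.exists_finrank_le_gonality [Algebra.IsAlgebraic k K]
    (hspan : Submodule.span K (Set.range (algebraMap F E)) = ⊤) (hF : IsFunctionField k F) :
    ∃ f : E, Transcendental K f ∧ FiniteDimensional K⟮f⟯ E ∧
      Module.finrank K⟮f⟯ E ≤ gonality k F := by
  obtain ⟨f, hf, hfd⟩ := hF.exists_finrank_eq_gonality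
  have := hF.finiteDimensional_adjoin hf
  exact ⟨algebraMap F E f, transcendental_algebraMap_of_isAlgebraic hf,
    finiteDimensional_adjoin_algebraMap (k := k) hspan,
    hfd ▸ finrank_adjoin_algebraMap_le (k := k) hspan⟩

lemma IsFunctionField.of_span_eq_top [Algebra.IsAlgebraic k K]
    (hspan : Submodule.span K (Set.range (algebraMap F E)) = ⊤) (hF : IsFunctionField k F) :
    IsFunctionField K E := by
  obtain ⟨f, hf, hfin, -⟩ := hF.exists_finrank_le_gonality hspan
  exact ⟨f, hf, hfin⟩

end BaseChange

section Pushout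

variable {k F K E : Type*} [Field k] [Field F] [Field K] [Field E] [Algebra k F] [Algebra k K]
  [Algebra k E] [Algebra F E] [Algebra K E] [IsScalarTower k F E] [IsScalarTower k K E]

lemma Algebra.IsPushout.span_range_algebraMap (h : Algebra.IsPushout k K F E) :
    Submodule.span K (Set.range (algebraMap F E)) = ⊤ := by
  rw [_root_.eq_top_iff, ← (h.out.basis (Module.Basis.ofVectorSpace k F)).span_eq]
  refine Submodule.span_mono ?_
  rintro _ ⟨i, rfl⟩
  exact ⟨_, (IsBaseChange.basis_apply _ h.out i).symm⟩

lemma Algebra.IsPushout.linearIndependent_algebraMap_comp (h : Algebra.IsPushout k K F E)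
    {ι : Type*} {y : ι → F} (hy : LinearIndependent k y) :
    LinearIndependent K (algebraMap F E ∘ y) := by
  have hs := hy.linearIndepOn_id
  have hb := (h.out.basis (Module.Basis.extend hs)).linearIndependent
  have hmem (i) : y i ∈ hs.extend (Set.subset_univ _) := hs.subset_extend _ ⟨i, rfl⟩
  have hinj : Function.Injective
      (fun i => (⟨y i, hmem i⟩ : hs.extend (Set.subset_univ _))) := fun i j hij =>
    hy.injective (congrArg Subtype.val hij)
  have heq : (algebraMap F E ∘ y) =
      h.out.basis (Module.Basis.extend hs) ∘ (fun i => ⟨y i, hmem i⟩) := by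
    ext i
    simp [IsBaseChange.basis_apply]
  rw [heq]
  exact hb.comp _ hinj

/-- The automorphism of `E = F ⊗ K` over `F` induced by an automorphism of `K` over `k`. -/
noncomputable def Algebra.IsPushout.baseChangeEquiv (h : Algebra.IsPushout k K F E)
    (σ : K ≃ₐ[k] K) : E ≃ₐ[F] E :=
  haveI := h.symm
  (Algebra.IsPushout.equiv k F K E).symm.trans
    ((Algebra.TensorProduct.congr AlgEquiv.refl σ).trans (Algebra.IsPushout.equiv k F K E))

lemma Algebra.IsPushout.baseChangeEquiv_algebraMap (h : Algebra.IsPushout k K F E)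
    (σ : K ≃ₐ[k] K) (c : K) :
    h.baseChangeEquiv σ (algebraMap K E c) = algebraMap K E (σ c) := by
  have := h.symm
  simp [baseChangeEquiv, Algebra.IsPushout.equiv_symm_algebraMap_right,
    Algebra.IsPushout.equiv_tmul]

lemma Algebra.IsPushout.finrank_adjoin_baseChangeEquiv (h : Algebra.IsPushout k K F E)
    (σ : K ≃ₐ[k] K) (z : E) :
    Module.finrank K⟮h.baseChangeEquiv σ z⟯ E = Module.finrank K⟮z⟯ E := by
  set s := h.baseChangeEquiv σ with hs
  have hle (τ : K ≃ₐ[k] K) (w x : E) (hx : x ∈ K⟮w⟯) :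
      h.baseChangeEquiv τ x ∈ K⟮h.baseChangeEquiv τ w⟯ := by
    induction hx using IntermediateField.adjoin_induction with
    | mem x hx =>
      rw [Set.mem_singleton_iff.1 hx]
      exact mem_adjoin_simple_self _ _
    | algebraMap c =>
      rw [h.baseChangeEquiv_algebraMap]
      exact IntermediateField.algebraMap_mem _ _
    | add x y _ _ hx hy => rw [map_add]; exact add_mem hx hy
    | inv x _ hx => rw [map_inv₀]; exact inv_mem hx
    | mul x y _ _ hx hy => rw [map_mul]; exact mul_mem hx hy
  have hsymm (w : E) : h.baseChangeEquiv σ.symm w = s.symm w := by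
    have := h.symm
    simp only [hs, baseChangeEquiv, AlgEquiv.trans_apply, AlgEquiv.symm_trans_apply,
      AlgEquiv.symm_symm]
    rfl
  let e : K⟮z⟯ ≃+* K⟮s z⟯ :=
    { toFun := fun x => ⟨s x, hle σ z x x.2⟩
      invFun := fun x => ⟨s.symm x, by
        have := hle σ.symm (s z) x x.2
        rwa [hsymm, hsymm, s.symm_apply_apply] at this⟩
      left_inv := fun x => by simp
      right_inv := fun x => by simp
      map_mul' := fun x y => by ext; simp
      map_add' := fun x y => by ext; simp }
  exact (Algebra.finrank_eq_of_equiv_equiv e s.toRingEquiv rfl).symm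

end Pushout

section Dominating

variable {k F K E : Type*} [Field k] [Field F] [Field K] [Field E] [Algebra k F] [Algebra k K]
  [Algebra k E] [Algebra F E] [Algebra K E] [IsScalarTower k F E] [IsScalarTower k K E]

lemma ValuationSubring.exists_dominating (O : ValuationSubring F) :
    ∃ A : ValuationSubring E, (∀ y ∈ O, algebraMap F E y ∈ A) ∧
      ∀ y : F, O.valuation y < 1 → A.valuation (algebraMap F E y) < 1 := by
  let φ : O →+* E := (algebraMap F E).comp O.subtype
  have hφ : Function.Injective φ := (algebraMap F E).injective.comp Subtype.val_injective
  let e := φ.rangeRestrict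
  have he : Function.Bijective e := ⟨fun x y hxy => hφ (congrArg Subtype.val hxy),
    φ.rangeRestrict_surjective⟩
  let e' := RingEquiv.ofBijective e he
  obtain ⟨A, hO, hA⟩ := Ideal.image_subset_nonunits_valuationSubring
    ((IsLocalRing.maximalIdeal O).comap (e'.symm : φ.range →+* O)) (Ideal.comap_ne_top _
      (IsLocalRing.maximalIdeal.isMaximal O).ne_top)
  refine ⟨A, fun y hy => hO ⟨⟨y, hy⟩, rfl⟩, fun y hy => ?_⟩
  have hyO : y ∈ O := O.mem_of_valuation_le_one _ hy.le
  refine A.mem_nonunits_iff.1 (hA ⟨e' ⟨y, hyO⟩, ?_, rfl⟩)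
  simp only [SetLike.mem_coe, Ideal.mem_comap]
  rw [RingEquiv.coe_toRingHom, RingEquiv.symm_apply_apply]
  exact (O.valuation_lt_one_iff ⟨y, hyO⟩).2 hy

lemma FFPlace.exists_valuation_sub_lt_one {P : FFPlace k F} (hP : P.degree = 1) {y : F}
    (hy : P.asSubring.valuation y ≤ 1) :
    ∃ r : k, P.asSubring.valuation (y - algebraMap k F r) < 1 := by
  let : Algebra k (IsLocalRing.ResidueField P.asSubring) :=
    ((IsLocalRing.residue (P.asSubring : Type _)).comp
      ((algebraMap k F).codRestrict P.asSubring.toSubring P.algebraMap_mem)).toAlgebra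
  have h1 : Module.finrank k (IsLocalRing.ResidueField P.asSubring) = 1 := hP
  have hyP := P.asSubring.mem_of_valuation_le_one _ hy
  obtain ⟨r, hr⟩ := (finrank_eq_one_iff_of_nonzero' (1 : IsLocalRing.ResidueField P.asSubring)
    one_ne_zero).1 h1 (IsLocalRing.residue _ ⟨y, hyP⟩)
  rw [Algebra.smul_def, mul_one] at hr
  refine ⟨r, ?_⟩
  have h2 : IsLocalRing.residue P.asSubring
      (⟨y, hyP⟩ - ⟨algebraMap k F r, P.algebraMap_mem r⟩) = 0 := by
    rw [map_sub, ← hr]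
    exact sub_self _
  exact (P.asSubring.valuation_lt_one_iff _).1 ((IsLocalRing.residue_eq_zero_iff _).1 h2)

/-- If a place of `F` has degree one, then every nonzero element of `E = F ⊗ K` is, up to a factor
in `F`, a nonzero constant plus an element of the extension of the maximal ideal. -/
lemma FFPlace.exists_eq_mul_add (h : Algebra.IsPushout k K F E) {P : FFPlace k F}
    (hP : P.degree = 1) {z : E} (hz : z ≠ 0) :
    ∃ x : F, x ≠ 0 ∧ ∃ c : K, c ≠ 0 ∧
      ∃ μ ∈ Submodule.span K (algebraMap F E '' {y | P.asSubring.valuation y < 1}),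
        z = algebraMap F E x * (algebraMap K E c + μ) := by
  classical
  set v := P.asSubring.valuation
  let a := Module.Basis.ofVectorSpace k K
  let b := h.symm.out.basis a
  have hb (i) : b i = algebraMap K E (a i) := IsBaseChange.basis_apply _ h.symm.out i
  have hsupp : (b.repr z).support.Nonempty := by
    rwa [Finsupp.support_nonempty_iff, ne_eq, EmbeddingLike.map_eq_zero_iff]
  obtain ⟨j, hj, hmax⟩ := (b.repr z).support.exists_max_image (fun i => v (b.repr z i)) hsupp
  set x := b.repr z j
  have hx : x ≠ 0 := Finsupp.mem_support_iff.1 hj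
  have hvx : 0 < v x := by simpa [zero_lt_iff] using hx
  have hle (i) : v (b.repr z i / x) ≤ 1 := by
    rw [map_div₀, div_le_one₀ hvx]
    by_cases hi : b.repr z i = 0
    · simp [hi]
    · exact hmax i (Finsupp.mem_support_iff.2 hi)
  choose r hr using fun i => P.exists_valuation_sub_lt_one hP (hle i)
  have hrj : r j ≠ 0 := by
    intro h0
    have := hr j
    rw [h0, map_zero, sub_zero, div_self hx, map_one] at this
    exact this.false
  refine ⟨x, hx, ∑ i ∈ (b.repr z).support, r i • a i, ?_,
    ∑ i ∈ (b.repr z).support, a i • algebraMap F E (b.repr z i / x - algebraMap k F (r i)),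
    Submodule.sum_mem _ fun i _ => Submodule.smul_mem _ _ (Submodule.subset_span ⟨_, hr i, rfl⟩),
    ?_⟩
  · intro h0
    exact hrj (linearIndependent_iff'.1 a.linearIndependent _ _ h0 j hj)
  · rw [map_sum, ← Finset.sum_add_distrib, Finset.mul_sum]
    conv_lhs => rw [← b.linearCombination_repr z, Finsupp.linearCombination_apply, Finsupp.sum]
    refine Finset.sum_congr rfl fun i _ => ?_
    have hx' : algebraMap F E x ≠ 0 := by simpa using hx
    rw [hb, Algebra.smul_def, Algebra.smul_def, Algebra.smul_def, map_mul, map_sub, map_div₀,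
      ← IsScalarTower.algebraMap_apply k F E, ← IsScalarTower.algebraMap_apply k K E]
    field_simp
    ring

end Dominating

section Descent

variable {k F K E : Type*} [Field k] [Field F] [Field K] [Field E] [Algebra k F] [Algebra k K]
  [Algebra k E] [Algebra F E] [Algebra K E] [IsScalarTower k F E] [IsScalarTower k K E]

lemma ValuationSubring.valuation_algebraMap_of_isAlgebraic [Algebra.IsAlgebraic k K]
    {A : ValuationSubring E} (hA : ∀ r : k, algebraMap k E r ∈ A) {c : K} (hc : c ≠ 0) :
    A.valuation (algebraMap K E c) = 1 := by
  have hmem (c : K) : algebraMap K E c ∈ A := by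
    let ψ : k →+* A := (algebraMap k E).codRestrict A.toSubring hA
    have hint : (algebraMap k E).IsIntegralElem (algebraMap K E c) :=
      (Algebra.IsIntegral.isIntegral (R := k) c).algebraMap
    have : IsIntegral A (algebraMap K E c) := by
      obtain ⟨p, hp, hp0⟩ := hint
      refine ⟨p.map ψ, hp.map ψ, ?_⟩
      rw [Polynomial.eval₂_map]
      exact hp0
    obtain ⟨a, ha⟩ := IsIntegrallyClosed.isIntegral_iff.1 this
    exact ha ▸ a.2
  refine le_antisymm ((A.valuation_le_one_iff _).2 (hmem c)) ?_
  have := (A.valuation_le_one_iff _).2 (hmem c⁻¹)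
  rw [map_inv₀, map_inv₀] at this
  rwa [inv_le_one₀ (by simpa [zero_lt_iff] using hc)] at this

/-- A rational place of `F` extends to a valuation of `E = F ⊗ K` which is trivial on `K`, has
residue field `K`, and is invariant under the automorphisms of `K`. -/
lemma FFPlace.exists_invariant_valuationSubring [Algebra.IsAlgebraic k K]
    (h : Algebra.IsPushout k K F E) {P : FFPlace k F} (hP : P.degree = 1) :
    ∃ A : ValuationSubring E, (∀ c : K, c ≠ 0 → A.valuation (algebraMap K E c) = 1) ∧
      (∀ z : E, A.valuation z ≤ 1 → ∃ c : K, A.valuation (z - algebraMap K E c) < 1) ∧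
      ∀ (σ : K ≃ₐ[k] K) (z : E), A.valuation (h.baseChangeEquiv σ z) = A.valuation z := by
  obtain ⟨A, hO, hA⟩ := P.asSubring.exists_dominating (E := E)
  have hK (c : K) (hc : c ≠ 0) : A.valuation (algebraMap K E c) = 1 :=
    A.valuation_algebraMap_of_isAlgebraic (k := k) (fun r => by
      rw [IsScalarTower.algebraMap_apply k F E]
      exact hO _ (P.algebraMap_mem r)) hc
  have hK' (c : K) : A.valuation (algebraMap K E c) ≤ 1 := by
    obtain rfl | hc := eq_or_ne c 0
    · simp
    · exact (hK c hc).le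
  have hF {x : F} (hx : A.valuation (algebraMap F E x) ≤ 1) : P.asSubring.valuation x ≤ 1 := by
    by_contra! hlt
    have := hA x⁻¹ (by rw [map_inv₀]; exact inv_lt_one_of_one_lt₀ hlt)
    rw [map_inv₀, map_inv₀, inv_lt_one_iff₀] at this
    obtain h0 | h1 := this
    · have hx0 : x = 0 := by simpa using h0
      simp [hx0] at hlt
    · exact h1.not_ge hx
  let S := Submodule.span K (algebraMap F E '' {y | P.asSubring.valuation y < 1})
  have hS {μ : E} (hμ : μ ∈ S) : A.valuation μ < 1 := by
    induction hμ using Submodule.span_induction with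
    | mem x hx =>
      obtain ⟨y, hy, rfl⟩ := hx
      exact hA y hy
    | zero => simp
    | add x y _ _ hx hy => exact (A.valuation.map_add x y).trans_lt (max_lt hx hy)
    | smul c x _ hx =>
      rw [Algebra.smul_def, map_mul]
      exact mul_lt_one_of_nonneg_of_lt_one_right (hK' c) zero_le hx
  have hu {c : K} (hc : c ≠ 0) {μ : E} (hμ : μ ∈ S) :
      A.valuation (algebraMap K E c + μ) = 1 := by
    rw [A.valuation.map_add_eq_of_lt_left (by rw [hK c hc]; exact hS hμ), hK c hc]
  have hσ (σ : K ≃ₐ[k] K) {μ : E} (hμ : μ ∈ S) : h.baseChangeEquiv σ μ ∈ S := by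
    induction hμ using Submodule.span_induction with
    | mem x hx =>
      obtain ⟨y, hy, rfl⟩ := hx
      rw [AlgEquiv.commutes]
      exact Submodule.subset_span ⟨y, hy, rfl⟩
    | zero => simp
    | add x y _ _ hx hy => rw [map_add]; exact add_mem hx hy
    | smul c x _ hx =>
      rw [Algebra.smul_def, map_mul, h.baseChangeEquiv_algebraMap, ← Algebra.smul_def]
      exact S.smul_mem _ hx
  refine ⟨A, hK, fun z hz => ?_, fun σ z => ?_⟩
  · obtain rfl | hz0 := eq_or_ne z 0
    · exact ⟨0, by simp⟩
    obtain ⟨x, hx, c, hc, μ, hμ, rfl⟩ := P.exists_eq_mul_add h hP hz0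
    rw [map_mul, hu hc hμ, mul_one] at hz
    obtain ⟨r, hr⟩ := P.exists_valuation_sub_lt_one hP (hF hz)
    refine ⟨algebraMap k K r * c, ?_⟩
    have heq : algebraMap F E x * (algebraMap K E c + μ) - algebraMap K E (algebraMap k K r * c) =
        algebraMap F E (x - algebraMap k F r) * algebraMap K E c + algebraMap F E x * μ := by
      rw [map_mul, map_sub, ← IsScalarTower.algebraMap_apply k F E,
        ← IsScalarTower.algebraMap_apply k K E]
      ring
    rw [heq]
    refine (A.valuation.map_add _ _).trans_lt (max_lt ?_ ?_)
    · rw [map_mul, hK c hc, mul_one]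
      exact hA _ hr
    · rw [map_mul]
      exact mul_lt_one_of_nonneg_of_lt_one_right hz zero_le (hS hμ)
  · obtain rfl | hz0 := eq_or_ne z 0
    · simp
    obtain ⟨x, hx, c, hc, μ, hμ, rfl⟩ := P.exists_eq_mul_add h hP hz0
    rw [map_mul, map_add, AlgEquiv.commutes, h.baseChangeEquiv_algebraMap, map_mul, map_mul,
      hu hc hμ, hu (by simpa using hc) (hσ σ hμ)]

lemma Algebra.IsPushout.repr_baseChangeEquiv (h : Algebra.IsPushout k K F E) {ι : Type*}
    (b : Module.Basis ι k F) (σ : K ≃ₐ[k] K) (z : E) (i : ι) :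
    (h.out.basis b).repr (h.baseChangeEquiv σ z) i = σ ((h.out.basis b).repr z i) := by
  classical
  induction (h.out.basis b).mem_span z using Submodule.span_induction with
  | mem z hz =>
    obtain ⟨j, rfl⟩ := hz
    have hj : h.out.basis b j = algebraMap F E (b j) := IsBaseChange.basis_apply _ h.out j
    have hs : h.baseChangeEquiv σ (h.out.basis b j) = h.out.basis b j := by
      rw [hj, AlgEquiv.commutes]
    rw [hs, Module.Basis.repr_self, Finsupp.single_apply]
    split_ifs <;> simp
  | zero => simp
  | add x y _ _ hx hy => simp [hx, hy]
  | smul c x _ hx =>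
    rw [Algebra.smul_def, map_mul, h.baseChangeEquiv_algebraMap, ← Algebra.smul_def,
      ← Algebra.smul_def, map_smul, map_smul, Finsupp.smul_apply, Finsupp.smul_apply, hx,
      smul_eq_mul, smul_eq_mul, map_mul]

lemma Algebra.IsPushout.mem_range_of_forall_baseChangeEquiv_eq [IsGalois k K]
    (h : Algebra.IsPushout k K F E) {z : E} (hz : ∀ σ, h.baseChangeEquiv σ z = z) :
    ∃ x : F, algebraMap F E x = z := by
  let e := Module.Basis.ofVectorSpace k F
  let b := h.out.basis e
  have hfix (i) : b.repr z i ∈ Set.range (algebraMap k K) := by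
    rw [InfiniteGalois.mem_range_algebraMap_iff_fixed]
    intro σ
    rw [← h.repr_baseChangeEquiv, hz]
  choose r hr using hfix
  refine ⟨∑ i ∈ (b.repr z).support, r i • e i, ?_⟩
  conv_rhs => rw [← b.linearCombination_repr z, Finsupp.linearCombination_apply, Finsupp.sum]
  rw [map_sum]
  refine Finset.sum_congr rfl fun i _ => ?_
  have hi : b i = algebraMap F E (e i) := IsBaseChange.basis_apply _ h.out i
  rw [hi, ← hr, Algebra.smul_def, Algebra.smul_def, map_mul,
    ← IsScalarTower.algebraMap_apply k F E, ← IsScalarTower.algebraMap_apply k K E]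

/-- A generator of a rational subfield which is moved by affine maps only can be normalized so as
to be defined over the ground field. -/
lemma Algebra.IsPushout.exists_adjoin_algebraMap_eq [IsGalois k K]
    (h : Algebra.IsPushout k K F E) {g : E} (hg : Transcendental K g)
    (haff : ∀ σ, ∃ a b : K,
      h.baseChangeEquiv σ g = algebraMap K E a * g + algebraMap K E b) :
    ∃ x : F, K⟮algebraMap F E x⟯ = K⟮g⟯ := by
  classical
  have hs : LinearIndepOn k _root_.id ({1} : Set F) :=
    LinearIndepOn.singleton one_ne_zero
  let e := Module.Basis.extend hs
  let i₀ : hs.extend (Set.subset_univ _) := ⟨1, hs.subset_extend _ rfl⟩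
  have he : e i₀ = 1 := Module.Basis.extend_apply_self hs i₀
  let B := h.out.basis e
  have hB : B i₀ = 1 := by
    have : B i₀ = algebraMap F E (e i₀) := IsBaseChange.basis_apply _ h.out i₀
    rw [this, he, map_one]
  have hconst (b : K) : B.repr (algebraMap K E b) = Finsupp.single i₀ b := by
    rw [Algebra.algebraMap_eq_smul_one, ← hB, map_smul, B.repr_self, Finsupp.smul_single,
      smul_eq_mul, mul_one]
  obtain ⟨i, hi, hci⟩ : ∃ i, i ≠ i₀ ∧ B.repr g i ≠ 0 := by
    by_contra! hall
    have : g = algebraMap K E (B.repr g i₀) := by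
      apply B.repr.injective
      rw [hconst]
      ext j
      obtain rfl | hj := eq_or_ne j i₀
      · simp
      · rw [hall j hj, Finsupp.single_eq_of_ne hj]
    exact hg (this ▸ isAlgebraic_algebraMap _)
  set c := B.repr g i₀ with hc
  set d := B.repr g i with hd
  have hd' : algebraMap K E d ≠ 0 := by simpa using hci
  obtain ⟨x, hx⟩ := h.mem_range_of_forall_baseChangeEquiv_eq
    (z := (g - algebraMap K E c) / algebraMap K E d) fun σ => by
      obtain ⟨a, b, hab⟩ := haff σ
      have hrepr (j) : σ (B.repr g j) = a * B.repr g j + Finsupp.single i₀ b j := by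
        rw [← h.repr_baseChangeEquiv, hab, map_add, Finsupp.add_apply, ← hconst,
          ← Algebra.smul_def, map_smul, Finsupp.smul_apply, smul_eq_mul]
      have hσc : σ c = a * c + b := by rw [hc, hrepr, Finsupp.single_eq_same]
      have hσd : σ d = a * d := by rw [hd, hrepr, Finsupp.single_eq_of_ne hi, add_zero]
      have ha : algebraMap K E a ≠ 0 := by
        have : a ≠ 0 := by
          rintro rfl
          rw [zero_mul] at hσd
          exact hci (by simpa using hσd)
        simpa using this
      rw [map_div₀, map_sub, h.baseChangeEquiv_algebraMap, h.baseChangeEquiv_algebraMap, hab, hσc,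
        hσd, map_mul, map_add, map_mul, add_sub_add_right_eq_sub, ← mul_sub,
        mul_div_mul_left _ _ ha]
  refine ⟨x, hx ▸ le_antisymm (adjoin_simple_le_iff.2 ?_) (adjoin_simple_le_iff.2 ?_)⟩
  · exact div_mem (sub_mem (mem_adjoin_simple_self K g) (IntermediateField.algebraMap_mem _ c))
      (IntermediateField.algebraMap_mem _ d)
  · set z := (g - algebraMap K E c) / algebraMap K E d with hz
    have : g = algebraMap K E d * z + algebraMap K E c := by
      rw [hz]
      field_simp
      ring
    rw [this]
    exact add_mem (mul_mem (IntermediateField.algebraMap_mem _ d) (mem_adjoin_simple_self K z))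
      (IntermediateField.algebraMap_mem _ c)

lemma IsFunctionField.gonality_le_of_finrank_le_two [IsAlgClosed K] [IsGalois k K]
    (h : Algebra.IsPushout k K F E) (hF : IsFunctionField k F)
    (hP : ∃ P : FFPlace k F, P.degree = 1) {f : E} (hf : Transcendental K f)
    (hd : Module.finrank K⟮f⟯ E ≤ 2) : gonality k F ≤ Module.finrank K⟮f⟯ E := by
  have hE := hF.of_span_eq_top h.span_range_algebraMap
  obtain ⟨P, hP⟩ := hP
  obtain ⟨A, hK, hres, hinv⟩ := P.exists_invariant_valuationSubring h hP
  obtain ⟨g, hg, hgd, hstab⟩ := A.valuation.exists_stable hK hres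
    (fun f hf => hE.finiteDimensional_adjoin hf)
    (fun (σ : K ≃ₐ[k] K) z => h.baseChangeEquiv σ z) hinv h.finrank_adjoin_baseChangeEquiv hf hd
  have hgt := A.valuation.transcendental_of_one_lt hK hg
  have := hE.finiteDimensional_adjoin hgt
  obtain ⟨x, hx⟩ := h.exists_adjoin_algebraMap_eq hgt fun σ => by
    have hσ : 1 < A.valuation (h.baseChangeEquiv σ g) := by rwa [hinv]
    have := hE.finiteDimensional_adjoin (A.valuation.transcendental_of_one_lt hK hσ)
    exact A.valuation.exists_affine_of_adjoin_eq hK hg hσ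
      (eq_of_le_of_finrank_eq' (adjoin_simple_le_iff.2 (hstab σ))
        (h.finrank_adjoin_baseChangeEquiv σ g))
  have hxt : Transcendental k x := by
    intro hxa
    have hxE : IsAlgebraic K (algebraMap F E x) := hxa.algebraMap.extendScalars
      (algebraMap k K).injective
    have := isAlgebraic_adjoin_simple hxE.isIntegral
    rw [hx] at this
    exact hgt (isAlgebraic_iff.1
      (Algebra.IsAlgebraic.isAlgebraic (⟨g, mem_adjoin_simple_self K g⟩ : K⟮g⟯)))
  have := hF.finiteDimensional_adjoin hxt
  have : FiniteDimensional K⟮algebraMap F E x⟯ E := hx ▸ ‹FiniteDimensional K⟮g⟯ E›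
  refine (gonality_le_finrank hxt).trans ((finrank_le_finrank_adjoin_algebraMap (K := K) hxt
    fun y hy => h.linearIndependent_algebraMap_comp hy).trans ?_)
  rwa [hx]

end Descent

section FractionField

open TensorProduct

lemma Algebra.IsPushout.of_isFractionRing {k F K M : Type*} [Field k] [Field F] [Field K] [Field M]
    [Algebra k F] [Algebra k K] [Algebra k M] [Algebra F M] [Algebra K M] [IsScalarTower k F M]
    [IsScalarTower k K M] [Algebra.IsAlgebraic k K] [IsDomain (K ⊗[k] F)] [Algebra (K ⊗[k] F) M]
    [IsFractionRing (K ⊗[k] F) M]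
    (hK : ∀ c : K, algebraMap K M c = algebraMap (K ⊗[k] F) M (c ⊗ₜ 1))
    (hF : ∀ x : F, algebraMap F M x = algebraMap (K ⊗[k] F) M (1 ⊗ₜ x)) :
    Algebra.IsPushout k K F M := by
  let : Algebra F (K ⊗[k] F) := Algebra.TensorProduct.rightAlgebra
  have hint : Algebra.IsIntegral F (K ⊗[k] F) := by
    refine ⟨fun z => ?_⟩
    induction z with
    | zero => exact isIntegral_zero
    | add x y hx hy => exact hx.add hy
    | tmul c x =>
      have hc : IsIntegral F (c ⊗ₜ[k] (1 : F)) :=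
        ((Algebra.IsIntegral.isIntegral (R := k) c).map
          (Algebra.TensorProduct.includeLeft : K →ₐ[k] K ⊗[k] F)).tower_top
      have hx : IsIntegral F ((1 : K) ⊗ₜ[k] x) := isIntegral_algebraMap (R := F) (x := x)
      simpa using hc.mul hx
  have hfield : IsField (K ⊗[k] F) := isField_of_isIntegral_of_isField' (Field.toIsField F)
  have hbij : Function.Bijective (algebraMap (K ⊗[k] F) M) :=
    ⟨IsFractionRing.injective _ M, IsFractionRing.surjective_iff_isField.2 hfield⟩
  let e : K ⊗[k] F ≃ₐ[K] M :=
    AlgEquiv.ofRingEquiv (f := RingEquiv.ofBijective _ hbij) fun c => (hK c).symm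
  have := TensorProduct.isPushout (R := k) (S := K) (T := F)
  exact Algebra.IsPushout.of_equiv e (RingHom.ext fun x => (hF x).symm)

end FractionField

lemma IsFunctionField.gonality_eq_of_isPushout {k F L M K E : Type*} [Field k] [Field F] [Field L]
    [Field M] [Field K] [Field E] [Algebra k F] [Algebra k L] [Algebra k M] [Algebra F M]
    [Algebra L M] [Algebra k K] [Algebra k E] [Algebra F E] [Algebra K E]
    [IsScalarTower k F M] [IsScalarTower k L M] [IsScalarTower k F E] [IsScalarTower k K E]
    [IsAlgClosed K] [IsGalois k K] [Algebra.IsAlgebraic k L] (hF : IsFunctionField k F)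
    (hM : Algebra.IsPushout k L F M) (hE : Algebra.IsPushout k K F E)
    (hP : ∃ P : FFPlace k F, P.degree = 1) (h2 : gonality L M ≤ 2) :
    gonality k F = gonality L M := by
  let φ : L →ₐ[k] K := IsAlgClosed.lift
  let ψ : M →ₐ[k] E := Algebra.pushoutDesc (R := k) (S := L) (R' := F) M
    ((IsScalarTower.toAlgHom k K E).comp φ) (IsScalarTower.toAlgHom k F E) fun _ _ => mul_comm _ _
  let : Algebra L K := φ.toRingHom.toAlgebra
  let : Algebra M E := ψ.toRingHom.toAlgebra
  let : Algebra L E := ((algebraMap K E).comp φ.toRingHom).toAlgebra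
  have : IsScalarTower k L K := IsScalarTower.of_algebraMap_eq fun x => (φ.commutes x).symm
  have : IsScalarTower L K E := IsScalarTower.of_algebraMap_eq fun _ => rfl
  have : IsScalarTower L M E := IsScalarTower.of_algebraMap_eq fun x =>
    (Algebra.pushoutDesc_left (R := k) (S := L) (R' := F) M
      ((IsScalarTower.toAlgHom k K E).comp φ) (IsScalarTower.toAlgHom k F E)
      (fun _ _ => mul_comm _ _) x).symm
  have : Algebra.IsAlgebraic L K := Algebra.IsAlgebraic.tower_top (K := k) L
  have hspan : Submodule.span K (Set.range (algebraMap M E)) = ⊤ := by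
    rw [_root_.eq_top_iff, ← hE.span_range_algebraMap]
    refine Submodule.span_mono ?_
    rintro _ ⟨x, rfl⟩
    exact ⟨algebraMap F M x, Algebra.pushoutDesc_right (R := k) (S := L) (R' := F) M _ _ _ x⟩
  refine le_antisymm ?_ ?_
  · obtain ⟨f, hf, -, hd⟩ :=
      (hF.of_span_eq_top hM.span_range_algebraMap).exists_finrank_le_gonality hspan
    exact (hF.gonality_le_of_finrank_le_two hE hP hf (hd.trans h2)).trans hd
  · obtain ⟨f, hf, -, hd⟩ := hF.exists_finrank_le_gonality hM.span_range_algebraMap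
    exact (gonality_le_finrank hf).trans hd

lemma IsFunctionField.gonality_eq_of_isFractionRing {k F L : Type*} [Field k] [Field F]
    [Algebra k F] [PerfectField k] (hF : IsFunctionField k F) [Field L] [Algebra k L]
    [Algebra.IsAlgebraic k L] (M E : Type*) [Field M] [Field E]
    [IsDomain (TensorProduct k (AlgebraicClosure k) F)] [IsDomain (TensorProduct k L F)]
    [Algebra (TensorProduct k L F) M] [IsFractionRing (TensorProduct k L F) M]
    [Algebra (TensorProduct k (AlgebraicClosure k) F) E]
    [IsFractionRing (TensorProduct k (AlgebraicClosure k) F) E]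
    (hP : ∃ P : FFPlace k F, P.degree = 1) :
    letI : Algebra L M :=
      ((algebraMap (TensorProduct k L F) M).comp (algebraMap L (TensorProduct k L F))).toAlgebra
    gonality L M ≤ 2 → gonality k F = gonality L M := by
  intro h2
  let : Algebra L M :=
    ((algebraMap (TensorProduct k L F) M).comp (algebraMap L (TensorProduct k L F))).toAlgebra
  let : Algebra k M :=
    ((algebraMap L M).comp (algebraMap k L)).toAlgebra
  let : Algebra F M := ((algebraMap (TensorProduct k L F) M).comp
    (Algebra.TensorProduct.includeRight : F →ₐ[k] TensorProduct k L F).toRingHom).toAlgebra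
  let : Algebra (AlgebraicClosure k) E :=
    ((algebraMap (TensorProduct k (AlgebraicClosure k) F) E).comp (algebraMap (AlgebraicClosure k)
      (TensorProduct k (AlgebraicClosure k) F))).toAlgebra
  let : Algebra k E := ((algebraMap (AlgebraicClosure k) E).comp
    (algebraMap k (AlgebraicClosure k))).toAlgebra
  let : Algebra F E := ((algebraMap (TensorProduct k (AlgebraicClosure k) F) E).comp
    (Algebra.TensorProduct.includeRight :
      F →ₐ[k] TensorProduct k (AlgebraicClosure k) F).toRingHom).toAlgebra
  have : IsScalarTower k L M := IsScalarTower.of_algebraMap_eq fun _ => rfl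
  have : IsScalarTower k F M := IsScalarTower.of_algebraMap_eq fun x =>
    congrArg (algebraMap (TensorProduct k L F) M)
      ((Algebra.TensorProduct.includeRight : F →ₐ[k] TensorProduct k L F).commutes x).symm
  have : IsScalarTower k (AlgebraicClosure k) E :=
    IsScalarTower.of_algebraMap_eq fun _ => rfl
  have : IsScalarTower k F E := IsScalarTower.of_algebraMap_eq fun x =>
    congrArg (algebraMap (TensorProduct k (AlgebraicClosure k) F) E)
      ((Algebra.TensorProduct.includeRight :
        F →ₐ[k] TensorProduct k (AlgebraicClosure k) F).commutes x).symm
  exact hF.gonality_eq_of_isPushout (K := AlgebraicClosure k) (E := E)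
    (Algebra.IsPushout.of_isFractionRing (fun _ => rfl) fun _ => rfl)
    (Algebra.IsPushout.of_isFractionRing (fun _ => rfl) fun _ => rfl) hP h2

/-- let `X` be a geometrically integral curve over a perfect field `k` with
function field `F = k(X)`, let `L ⊇ k` be an algebraic field extension, and let
`d = γ_L(X)` (the gonality of the function field `Frac(L ⊗_k F)` of `X_L` over `L`).
If `X` has a `k`-rational point (a place of degree 1) and `d ≤ 2`, then `γ_k(X) = d`. -/
theorem gonality_eq_of_baseChange_le_two
    (k F L : Type*) [Field k] [Field F] [Algebra k F] [PerfectField k]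
    (hF : IsFunctionField k F)
    [IsDomain (TensorProduct k (AlgebraicClosure k) F)]
    [Field L] [Algebra k L] [Algebra.IsAlgebraic k L]
    [IsDomain (TensorProduct k L F)]
    (hP : ∃ P : FFPlace k F, P.degree = 1) :
    letI : Algebra L (FractionRing (TensorProduct k L F)) :=
      ((algebraMap (TensorProduct k L F) (FractionRing (TensorProduct k L F))).comp
        (algebraMap L (TensorProduct k L F))).toAlgebra
    gonality L (FractionRing (TensorProduct k L F)) ≤ 2 →
      gonality k F = gonality L (FractionRing (TensorProduct k L F)) := by
  exact hF.gonality_eq_of_isFractionRing (FractionRing (TensorProduct k L F))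
    (FractionRing (TensorProduct k (AlgebraicClosure k) F)) hP
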